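/- arXiv:2005.12988 — 8 statements merged into one kernel-verified Lean document; each statement's English description precedes it below -/
import Mathlib

section
/- Let p, q, r ≥ 1 and let H = O(p) × O(q) × O(r) act on 3-way tensors T : Fin p → Fin q → Fin r → ℝ by ((B,C,D)·T)(i,j,k) = Σ_{i',j',k'} B_{i i'} C_{j j'} D_{k k'} T(i',j',k'). Call a colored Brauer diagram (σ,τ,ρ) on d vertices connected if the graph on Fin d whose edge set consists of all pairs {x, σ(x)}, {x, τ(x)}, {x, ρ(x)} is connected. Then the evaluation function of every multivariate polynomial in the variables T(i,j,k) that is H-invariant belongs to the ℝ-subalgebra of functions generated by the invariants P_{(σ,τ,ρ)}, where (σ,τ,ρ) ranges over all connected colored Brauer diagrams of all (even) sizes d. -/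
/-- A Brauer diagram on `d` vertices: a fixed-point-free involution of `Fin d`. -/
def IsBrauerDiagram {d : ℕ} (σ : Equiv.Perm (Fin d)) : Prop :=
  (∀ x, σ (σ x) = x) ∧ ∀ x, σ x ≠ x

/-- Connectedness of the colored Brauer diagram `(σ, τ, ρ)`: the graph on `Fin d` whose edges
are the pairs `{x, σ x}`, `{x, τ x}`, `{x, ρ x}` is connected. -/
def IsConnectedDiagram {d : ℕ} (σ τ ρ : Equiv.Perm (Fin d)) : Prop :=
  (SimpleGraph.fromRel (fun x y => σ x = y ∨ τ x = y ∨ ρ x = y)).Connected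

/-- The degree-`d` polynomial invariant associated to a colored Brauer diagram `(σ, τ, ρ)`. -/
noncomputable def diagramInvariant (p q r d : ℕ) (σ τ ρ : Equiv.Perm (Fin d))
    (T : Fin p → Fin q → Fin r → ℝ) : ℝ :=
  ∑ a ∈ Finset.univ.filter (fun a : Fin d → Fin p => a ∘ ⇑σ = a),
    ∑ b ∈ Finset.univ.filter (fun b : Fin d → Fin q => b ∘ ⇑τ = b),
      ∑ c ∈ Finset.univ.filter (fun c : Fin d → Fin r => c ∘ ⇑ρ = c),
        ∏ t : Fin d, T (a t) (b t) (c t)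

/-- The action of `O(p) × O(q) × O(r)` on 3-way tensors. -/
noncomputable def actTensor (p q r : ℕ) (B : Matrix (Fin p) (Fin p) ℝ)
    (C : Matrix (Fin q) (Fin q) ℝ) (D : Matrix (Fin r) (Fin r) ℝ)
    (T : Fin p → Fin q → Fin r → ℝ) : Fin p → Fin q → Fin r → ℝ :=
  fun i j k => ∑ i', ∑ j', ∑ k', B i i' * C j j' * D k k' * T i' j' k'

open MeasureTheory in
theorem integrable_pow_mul_exp_neg_sq_half (k : ℕ) :
    Integrable (fun x : ℝ => x ^ k * Real.exp (-(x ^ 2 / 2))) := by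
  have h := integrable_rpow_mul_exp_neg_mul_sq (b := 1 / 2) (by norm_num) (s := (k : ℝ))
    (by have : (0 : ℝ) ≤ k := Nat.cast_nonneg k
        linarith)
  refine h.congr (Filter.Eventually.of_forall fun x => ?_)
  change x ^ (k : ℝ) * _ = _
  rw [Real.rpow_natCast]
  congr 2
  ring

/-- The moments of the unnormalized standard Gaussian density on the line. -/
noncomputable def gaussMoment (k : ℕ) : ℝ := ∫ x : ℝ, x ^ k * Real.exp (-(x ^ 2 / 2))

open MeasureTheory in
theorem gaussMoment_succ (k : ℕ) : gaussMoment (k + 1) = k * gaussMoment (k - 1) := by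
  have hint := (integrable_pow_mul_exp_neg_sq_half (k - 1)).const_mul (k : ℝ)
  have h := integral_eq_zero_of_hasDerivAt_of_integrable
    (f := fun x : ℝ => x ^ k * Real.exp (-(x ^ 2 / 2)))
    (f' := fun x : ℝ => k * (x ^ (k - 1) * Real.exp (-(x ^ 2 / 2))) -
      x ^ (k + 1) * Real.exp (-(x ^ 2 / 2)))
    (fun x => by
      have h1 : HasDerivAt (fun x : ℝ => -(x ^ 2 / 2)) (-x) x := by
        refine ((hasDerivAt_pow 2 x).div_const 2).neg.congr_deriv ?_
        simp
      refine ((hasDerivAt_pow k x).mul h1.exp).congr_deriv ?_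
      ring)
    (hint.sub (integrable_pow_mul_exp_neg_sq_half (k + 1)))
    (integrable_pow_mul_exp_neg_sq_half k)
  rw [integral_sub hint (integrable_pow_mul_exp_neg_sq_half (k + 1)), integral_const_mul] at h
  simp only [gaussMoment]
  linarith

/-- The unnormalized Gaussian density on `κ → ℝ`. -/
noncomputable def gaussDensity {κ : Type*} [Fintype κ] (x : κ → ℝ) : ℝ :=
  ∏ k, Real.exp (-(x k ^ 2 / 2))

section GaussianMonomials

variable {ι κ : Type*} [Fintype κ] [DecidableEq κ]

theorem prod_mul_gaussDensity (h : ι → κ) (S : Finset ι) (x : κ → ℝ) :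
    (∏ t ∈ S, x (h t)) * gaussDensity x =
      ∏ k, (x k ^ (S.filter (fun t => h t = k)).card * Real.exp (-(x k ^ 2 / 2))) := by
  rw [Finset.prod_mul_distrib, gaussDensity, ← Finset.prod_fiberwise' S h x]
  simp only [Finset.prod_const]

theorem integrable_prod_mul_gaussDensity (h : ι → κ) (S : Finset ι) :
    MeasureTheory.Integrable (fun x : κ → ℝ => (∏ t ∈ S, x (h t)) * gaussDensity x) := by
  simp only [prod_mul_gaussDensity]
  exact MeasureTheory.Integrable.fintype_prod
    (f := fun k (y : ℝ) => y ^ (S.filter (fun t => h t = k)).card * Real.exp (-(y ^ 2 / 2)))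
    (fun k => integrable_pow_mul_exp_neg_sq_half _)

/-- The Gaussian integral of the monomial `∏ t ∈ S, x (h t)`. -/
noncomputable def gaussIntegral (h : ι → κ) (S : Finset ι) : ℝ :=
  ∫ x : κ → ℝ, (∏ t ∈ S, x (h t)) * gaussDensity x

theorem gaussIntegral_eq_prod (h : ι → κ) (S : Finset ι) :
    gaussIntegral h S = ∏ k, gaussMoment (S.filter (fun t => h t = k)).card := by
  simp only [gaussIntegral, prod_mul_gaussDensity, gaussMoment]
  exact MeasureTheory.integral_fintype_prod_volume_eq_prod
    (fun k (y : ℝ) => y ^ (S.filter (fun t => h t = k)).card * Real.exp (-(y ^ 2 / 2)))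

/-- Gaussian integration by parts (the recursive form of Wick's formula). -/
theorem gaussIntegral_insert [DecidableEq ι] (h : ι → κ) (S : Finset ι) {a : ι} (ha : a ∉ S) :
    gaussIntegral h (insert a S) =
      ∑ s ∈ S, if h a = h s then gaussIntegral h (S.erase s) else 0 := by
  have key : ∀ s ∈ S.filter (fun s => h a = h s), gaussIntegral h (S.erase s) =
      gaussMoment ((S.filter (fun t => h t = h a)).card - 1) *
        ∏ k ∈ Finset.univ.erase (h a), gaussMoment (S.filter (fun t => h t = k)).card := by
    intro s hs
    obtain ⟨hsS, hs⟩ := Finset.mem_filter.1 hs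
    rw [gaussIntegral_eq_prod, ← Finset.mul_prod_erase _ _ (Finset.mem_univ (h a))]
    congr 1
    · rw [Finset.filter_erase, Finset.card_erase_of_mem]
      simp [hsS, hs]
    · refine Finset.prod_congr rfl fun k hk => ?_
      rw [Finset.filter_erase, Finset.erase_eq_of_notMem]
      have := Finset.ne_of_mem_erase hk
      simp [← hs, this.symm]
  rw [← Finset.sum_filter, Finset.sum_congr rfl key, Finset.sum_const, nsmul_eq_mul,
    gaussIntegral_eq_prod, ← Finset.mul_prod_erase _ _ (Finset.mem_univ (h a)), ← mul_assoc]
  congr 1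
  · rw [Finset.filter_insert, if_pos rfl, Finset.card_insert_of_notMem (by simp [ha]),
      gaussMoment_succ]
    simp only [eq_comm]
  · refine Finset.prod_congr rfl fun k hk => ?_
    rw [Finset.filter_insert, if_neg (Finset.ne_of_mem_erase hk).symm]

end GaussianMonomials

section Pairings

variable {ι A : Type*} [DecidableEq A] [Fintype ι]

/-- The tensor equal to `1` on the index functions that are constant along the orbits of `σ`. -/
def pairingTensor (A : Type*) [DecidableEq A] (σ : Equiv.Perm ι) (i : ι → A) : ℝ :=
  if i ∘ ⇑σ = i then 1 else 0

/-- The span of the tensors of the involutions whose set of non-fixed points is `S`. -/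
def pairingSpan (A : Type*) [DecidableEq A] (S : Finset ι) : Submodule ℝ ((ι → A) → ℝ) :=
  Submodule.span ℝ {w | ∃ σ : Equiv.Perm ι, (∀ x, σ (σ x) = x) ∧ (∀ x, σ x ≠ x ↔ x ∈ S) ∧
    w = pairingTensor A σ}

theorem pairingSpan_insert [DecidableEq ι] {S : Finset ι} {a s : ι} (ha : a ∉ S) (hs : s ∈ S)
    {w : (ι → A) → ℝ} (hw : w ∈ pairingSpan A (S.erase s)) :
    (fun i => if i a = i s then w i else 0) ∈ pairingSpan A (insert a S) := by
  have has : a ≠ s := fun h => ha (h ▸ hs)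
  induction hw using Submodule.span_induction with
  | mem w hw =>
    obtain ⟨σ, hσ, hS, rfl⟩ := hw
    have hσs : σ s = s := by
      by_contra h
      simpa using (hS s).1 h
    have hσa : σ a = a := by
      by_contra h
      exact ha (Finset.mem_of_mem_erase ((hS a).1 h))
    have hne : ∀ x, x ≠ a → x ≠ s → σ x ≠ a ∧ σ x ≠ s := fun x hxa hxs =>
      ⟨fun h => hxa (by rw [← hσ x, h, hσa]), fun h => hxs (by rw [← hσ x, h, hσs])⟩
    have hval : ∀ x, x ≠ a → x ≠ s → (σ * Equiv.swap a s) x = σ x := fun x hxa hxs => by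
      simp [Equiv.swap_apply_of_ne_of_ne hxa hxs]
    have hva : (σ * Equiv.swap a s) a = s := by simp [hσs]
    have hvs : (σ * Equiv.swap a s) s = a := by simp [hσa]
    refine Submodule.subset_span ⟨σ * Equiv.swap a s, fun x => ?_, fun x => ?_, ?_⟩
    · by_cases hxa : x = a
      · rw [hxa, hva, hvs]
      by_cases hxs : x = s
      · rw [hxs, hvs, hva]
      rw [hval x hxa hxs, hval _ (hne x hxa hxs).1 (hne x hxa hxs).2, hσ]
    · by_cases hxa : x = a
      · rw [hxa, hva]
        simp [has.symm]
      by_cases hxs : x = s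
      · rw [hxs, hvs]
        simp [has, hs]
      rw [hval x hxa hxs, hS x]
      simp [hxa, hxs]
    · funext i
      simp only [pairingTensor, ← ite_and]
      congr 1
      simp only [funext_iff, Function.comp, eq_iff_iff]
      constructor
      · rintro ⟨h1, h2⟩ x
        by_cases hxa : x = a
        · rw [hxa, hva, h1]
        by_cases hxs : x = s
        · rw [hxs, hvs, h1]
        rw [hval x hxa hxs, h2]
      · intro h
        have h1 : i a = i s := by rw [← h s, hvs]
        refine ⟨h1, fun x => ?_⟩
        by_cases hxa : x = a
        · rw [hxa, hσa]
        by_cases hxs : x = s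
        · rw [hxs, hσs]
        rw [← hval x hxa hxs, h]
  | zero =>
    convert Submodule.zero_mem _
    simp
  | add x y _ _ hx hy =>
    convert Submodule.add_mem _ hx hy using 1
    funext i
    simp only [Pi.add_apply]
    split_ifs <;> simp
  | smul c x _ hx =>
    convert Submodule.smul_mem _ c hx using 1
    funext i
    simp

theorem gaussIntegral_mem_pairingSpan [DecidableEq ι] {A' : Type*} [Fintype A] [Fintype A']
    [DecidableEq A'] (j : ι → A') (S : Finset ι) :
    (fun i : ι → A => gaussIntegral (fun t => (i t, j t)) S) ∈ pairingSpan A S := by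
  induction S using Finset.strongInduction with
  | H S ih =>
    rcases S.eq_empty_or_nonempty with rfl | ⟨a, ha⟩
    · have : (fun i : ι → A => gaussIntegral (fun t => (i t, j t)) ∅) =
          (∏ _k : A × A', gaussMoment 0) • pairingTensor A (1 : Equiv.Perm ι) := by
        funext i
        rw [gaussIntegral_eq_prod]
        simp [pairingTensor]
      rw [this]
      exact Submodule.smul_mem _ _ (Submodule.subset_span ⟨1, by simp, by simp, rfl⟩)
    · have haS := Finset.notMem_erase a S
      have : (fun i : ι → A => gaussIntegral (fun t => (i t, j t)) S) =
          ∑ s ∈ S.erase a, (if j a = j s then (1 : ℝ) else 0) • fun i : ι → A =>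
            if i a = i s then gaussIntegral (fun t => (i t, j t)) ((S.erase a).erase s) else 0 := by
        funext i
        conv_lhs => rw [← Finset.insert_erase ha, gaussIntegral_insert _ _ haS]
        rw [Finset.sum_apply]
        refine Finset.sum_congr rfl fun s _ => ?_
        by_cases h1 : j a = j s <;> by_cases h2 : i a = i s <;> simp [h1, h2]
      rw [this]
      refine Submodule.sum_mem _ fun s hs => Submodule.smul_mem _ _ ?_
      have := pairingSpan_insert haS hs (ih _ ((Finset.erase_ssubset hs).trans_subset
        (Finset.erase_subset a S)))
      rwa [Finset.insert_erase ha] at this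

end Pairings

section TensorPower

open Matrix

variable {ι A : Type*} [Fintype ι]

/-- The matrix of the action of `B` on the tensor power indexed by `ι`. -/
def tensorPow (ι : Type*) [Fintype ι] {A : Type*} (B : Matrix A A ℝ) :
    Matrix (ι → A) (ι → A) ℝ :=
  Matrix.of fun i j => ∏ t, B (i t) (j t)

theorem tensorPow_apply (B : Matrix A A ℝ) (i j : ι → A) :
    tensorPow ι B i j = ∏ t, B (i t) (j t) := rfl

theorem tensorPow_transpose (B : Matrix A A ℝ) : tensorPow ι Bᵀ = (tensorPow ι B)ᵀ := rfl

theorem tensorPow_one [DecidableEq A] [DecidableEq (ι → A)] :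
    tensorPow ι (1 : Matrix A A ℝ) = 1 := by
  ext i j
  simp only [tensorPow_apply, Matrix.one_apply, Finset.prod_ite_zero, Finset.mem_univ,
    true_implies, Finset.prod_const_one, funext_iff]

variable [Fintype A] [DecidableEq ι]

theorem tensorPow_mul (B C : Matrix A A ℝ) :
    tensorPow ι (B * C) = tensorPow ι B * tensorPow ι C := by
  ext i j
  simp only [tensorPow_apply, Matrix.mul_apply, Fintype.prod_sum, Finset.prod_mul_distrib]

theorem dotProduct_tensorPow_mulVec (φ ψ : (ι → A) → ℝ) (G : Matrix A A ℝ) :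
    φ ⬝ᵥ tensorPow ι G *ᵥ ψ = ∑ i, ∑ j, φ i * ψ j * ∏ t, G (i t) (j t) := by
  simp only [dotProduct, Matrix.mulVec, Finset.mul_sum, tensorPow_apply]
  refine Finset.sum_congr rfl fun i _ => Finset.sum_congr rfl fun j _ => by ring

theorem continuous_dotProduct_tensorPow (φ ψ : (ι → A) → ℝ) :
    Continuous fun G : Matrix A A ℝ => φ ⬝ᵥ tensorPow ι G *ᵥ ψ := by
  simp only [dotProduct_tensorPow_mulVec]
  fun_prop

variable [DecidableEq A]

/-- A tensor of order `ι` fixed by the orthogonal group. -/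
def IsOrthogonalInvariant (φ : (ι → A) → ℝ) : Prop :=
  ∀ B ∈ Matrix.orthogonalGroup A ℝ, tensorPow ι B *ᵥ φ = φ

open scoped MatrixOrder in
theorem exists_orthogonal_mul_transpose_mul_self {G : Matrix A A ℝ} (hG : IsUnit G.det) :
    ∃ B ∈ Matrix.orthogonalGroup A ℝ, ∃ R : Matrix A A ℝ, G = B * (Rᵀ * R) := by
  have hP : (Gᵀ * G).PosSemidef := by
    simpa using Matrix.posSemidef_conjTranspose_mul_self G
  set S := CFC.sqrt (Gᵀ * G) with hSdef
  have hSS : S * S = Gᵀ * G := CFC.sqrt_mul_sqrt_self _ hP.nonneg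
  have hS : S.PosSemidef := (CFC.sqrt_nonneg _).posSemidef
  have hST : Sᵀ = S := by simpa using hS.isHermitian.eq
  have hR : (CFC.sqrt S).PosSemidef := (CFC.sqrt_nonneg _).posSemidef
  have hRT : (CFC.sqrt S)ᵀ = CFC.sqrt S := by simpa using hR.isHermitian.eq
  have hdet : IsUnit S.det := by
    have := congrArg Matrix.det hSS
    rw [Matrix.det_mul, Matrix.det_mul, Matrix.det_transpose] at this
    exact isUnit_of_mul_isUnit_left (this ▸ hG.mul hG)
  refine ⟨G * S⁻¹, ?_, CFC.sqrt S, ?_⟩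
  · rw [Matrix.mem_orthogonalGroup_iff', Matrix.transpose_mul, Matrix.transpose_nonsing_inv, hST]
    calc S⁻¹ * Gᵀ * (G * S⁻¹) = S⁻¹ * (Gᵀ * G) * S⁻¹ := by simp only [Matrix.mul_assoc]
      _ = 1 := by
        rw [← hSS, ← Matrix.mul_assoc, Matrix.nonsing_inv_mul _ hdet, Matrix.one_mul,
          Matrix.mul_nonsing_inv _ hdet]
  · rw [hRT, CFC.sqrt_mul_sqrt_self _ hS.nonneg, Matrix.mul_assoc, Matrix.nonsing_inv_mul _ hdet,
      Matrix.mul_one]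

theorem Matrix.dense_isUnit_det : Dense {G : Matrix A A ℝ | IsUnit G.det} := by
  intro G
  have hfin : {e : ℝ | (-G).charpoly.IsRoot e}.Finite :=
    Polynomial.finite_setOfPred_isRoot (Matrix.charpoly_monic _).ne_zero
  have hdense : Dense {e : ℝ | (-G).charpoly.IsRoot e}ᶜ := (Set.Finite.countable hfin).dense_compl ℝ
  have hc : Continuous fun e : ℝ => Matrix.scalar A e + G := by
    simp only [Matrix.scalar_apply]
    fun_prop
  have h0 : (fun e : ℝ => Matrix.scalar A e + G) 0 = G := by simp
  rw [← h0]
  refine hc.closure_preimage_subset _ (closure_mono ?_ (hdense 0))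
  intro e he
  simp only [Set.mem_compl_iff, Set.mem_ofPred_eq, Polynomial.IsRoot, Matrix.eval_charpoly,
    sub_neg_eq_add] at he
  exact isUnit_iff_ne_zero.2 he

theorem IsOrthogonalInvariant.dotProduct_nonneg {φ : (ι → A) → ℝ}
    (hφ : IsOrthogonalInvariant φ) (G : Matrix A A ℝ) : 0 ≤ φ ⬝ᵥ tensorPow ι G *ᵥ φ := by
  have hclosed : IsClosed {G : Matrix A A ℝ | 0 ≤ φ ⬝ᵥ tensorPow ι G *ᵥ φ} :=
    isClosed_le continuous_const (continuous_dotProduct_tensorPow φ φ)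
  refine hclosed.closure_subset_iff.2 ?_ (Matrix.dense_isUnit_det G)
  intro G hG
  obtain ⟨B, hB, R, rfl⟩ := exists_orthogonal_mul_transpose_mul_self hG
  have hB' : φ ᵥ* tensorPow ι B = φ := by
    have := hφ Bᵀ (by
      rw [Matrix.mem_orthogonalGroup_iff, Matrix.transpose_transpose]
      exact (Matrix.mem_orthogonalGroup_iff' _ _).1 hB)
    rwa [tensorPow_transpose, Matrix.mulVec_transpose] at this
  simp only [Set.mem_ofPred_eq]
  rw [tensorPow_mul, tensorPow_mul, ← Matrix.mulVec_mulVec, Matrix.dotProduct_mulVec, hB',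
    ← Matrix.mulVec_mulVec, Matrix.dotProduct_mulVec, tensorPow_transpose,
    Matrix.vecMul_transpose]
  exact Finset.sum_nonneg fun i _ => mul_self_nonneg _

open MeasureTheory in
theorem IsOrthogonalInvariant.eq_zero {φ : (ι → A) → ℝ} (hφ : IsOrthogonalInvariant φ)
    (horth : ∀ w ∈ pairingSpan A (Finset.univ : Finset ι), φ ⬝ᵥ w = 0) : φ = 0 := by
  let F : (A × A → ℝ) → ℝ := fun x => φ ⬝ᵥ tensorPow ι (Matrix.of fun a b => x (a, b)) *ᵥ φ
  have hF : ∀ x, F x * gaussDensity x = ∑ j, φ j * ∑ i, φ i *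
      ((∏ t, x ((fun t => (i t, j t)) t)) * gaussDensity x) := by
    intro x
    simp only [F, dotProduct_tensorPow_mulVec, Finset.sum_mul, Finset.mul_sum]
    rw [Finset.sum_comm]
    refine Finset.sum_congr rfl fun i _ => Finset.sum_congr rfl fun j _ => ?_
    simp only [Matrix.of_apply]
    ring
  have hterm : ∀ i j : ι → A, Integrable fun x : A × A → ℝ =>
      φ i * ((∏ t, x ((fun t => (i t, j t)) t)) * gaussDensity x) := fun i j =>
    (integrable_prod_mul_gaussDensity (fun t => (i t, j t)) Finset.univ).const_mul _
  have hterm' : ∀ j : ι → A, Integrable fun x : A × A → ℝ => φ j * ∑ i, φ i *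
      ((∏ t, x ((fun t => (i t, j t)) t)) * gaussDensity x) := fun j =>
    (integrable_finsetSum _ fun i _ => hterm i j).const_mul _
  have hzero : ∫ x, F x * gaussDensity x = 0 := by
    simp only [hF]
    rw [integral_finsetSum _ fun j _ => hterm' j]
    refine Finset.sum_eq_zero fun j _ => ?_
    rw [integral_const_mul, integral_finsetSum _ fun i _ => hterm i j]
    simp only [integral_const_mul]
    rw [show (∑ i, φ i * ∫ x : A × A → ℝ,
      (∏ t, x ((fun t => (i t, j t)) t)) * gaussDensity x) = 0 from
      horth _ (gaussIntegral_mem_pairingSpan j Finset.univ), mul_zero]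
  have hpos : ∀ x : A × A → ℝ, 0 < gaussDensity x := fun x =>
    Finset.prod_pos fun _ _ => Real.exp_pos _
  have hint : Integrable fun x => F x * gaussDensity x := by
    simp only [hF]
    exact integrable_finsetSum _ fun j _ => hterm' j
  have hcont : Continuous fun x => F x * gaussDensity x := by
    refine Continuous.mul ?_ ?_
    · exact (continuous_dotProduct_tensorPow φ φ).comp (by fun_prop)
    · unfold gaussDensity
      fun_prop
  have hae := (integral_eq_zero_iff_of_nonneg
    (fun x => mul_nonneg (hφ.dotProduct_nonneg _) (hpos x).le) hint).1 hzero
  have heq := (hcont.ae_eq_iff_eq volume continuous_zero).1 hae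
  have hone : F (fun k => (1 : Matrix A A ℝ) k.1 k.2) = 0 := by
    have := congrFun heq (fun k => (1 : Matrix A A ℝ) k.1 k.2)
    exact (mul_eq_zero.1 this).resolve_right (hpos _).ne'
  have : F (fun k => (1 : Matrix A A ℝ) k.1 k.2) = φ ⬝ᵥ φ := by
    change φ ⬝ᵥ tensorPow ι (1 : Matrix A A ℝ) *ᵥ φ = _
    rw [tensorPow_one, Matrix.one_mulVec]
  exact dotProduct_self_eq_zero.1 (this ▸ hone)

end TensorPower

section FirstFundamentalTheorem

open Matrix

variable {ι A : Type*} [Fintype ι] [LinearOrder ι] [Fintype A] [DecidableEq A]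

theorem sum_prod_of_comp_eq {σ : Equiv.Perm ι} (hσ : ∀ x, σ (σ x) = x)
    (hσ' : ∀ x, σ x ≠ x) (f : ι → A → ℝ) :
    ∑ j : ι → A with j ∘ ⇑σ = j, ∏ t, f t (j t) =
      ∏ t : {t : ι // t < σ t}, ∑ k, f t k * f (σ t) k := by
  have hprod : ∀ g : ι → ℝ, ∏ t, g t = ∏ t : {t : ι // t < σ t}, g t * g (σ t) := by
    intro g
    rw [Finset.prod_mul_distrib, ← Fintype.prod_subtype_mul_prod_subtype (fun t => t < σ t) g]
    congr 1
    have hmap : ∀ t, ¬ t < σ t ↔ σ t < σ (σ t) := fun t => by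
      rw [hσ, not_lt]
      exact ⟨fun h => lt_of_le_of_ne h (hσ' t), le_of_lt⟩
    refine Fintype.prod_equiv (σ.subtypeEquiv hmap) _ _ fun t => ?_
    simp [hσ]
  rw [Fintype.prod_sum]
  refine Finset.sum_bij' (fun j _ t => j t)
    (fun k _ t => if h : t < σ t then k ⟨t, h⟩ else k ⟨σ t, by
      rw [hσ]; exact lt_of_le_of_ne (not_lt.1 h) (hσ' _)⟩) ?_ ?_ ?_ ?_ ?_
  · simp
  · intro k _
    simp only [Finset.mem_filter, Finset.mem_univ, true_and]
    funext t
    simp only [Function.comp, hσ]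
    rcases lt_or_gt_of_ne (hσ' t) with h | h
    · rw [dif_pos h, dif_neg (not_lt.2 h.le)]
    · rw [dif_neg (not_lt.2 h.le), dif_pos h]
  · intro j hj
    have hj : j ∘ ⇑σ = j := by simpa using hj
    funext t
    split_ifs
    · rfl
    · exact congrFun hj t
  · intro k _
    funext t
    simp [t.2]
  · intro j hj
    have hj : j ∘ ⇑σ = j := by simpa using hj
    rw [hprod]
    refine Finset.prod_congr rfl fun t _ => ?_
    rw [show j (σ t) = j t from congrFun hj t]

theorem isOrthogonalInvariant_pairingTensor {σ : Equiv.Perm ι}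
    (hσ : ∀ x, σ (σ x) = x) (hσ' : ∀ x, σ x ≠ x) :
    IsOrthogonalInvariant (pairingTensor A σ) := by
  intro B hB
  funext i
  simp only [Matrix.mulVec, dotProduct, tensorPow_apply, pairingTensor, mul_ite, mul_one, mul_zero]
  rw [← Finset.sum_filter, sum_prod_of_comp_eq hσ hσ' (fun t k => B (i t) k)]
  have : ∀ a b, ∑ k, B a k * B b k = if a = b then 1 else 0 := fun a b => by
    rw [← Matrix.one_apply, ← (Matrix.mem_orthogonalGroup_iff _ _).1 hB, Matrix.mul_apply]
    rfl
  simp only [this, Finset.prod_ite_zero, Finset.prod_const_one, Finset.mem_univ, true_implies]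
  congr 1
  simp only [eq_iff_iff, funext_iff, Function.comp]
  constructor
  · intro h t
    rcases lt_or_gt_of_ne (hσ' t) with ht | ht
    · simpa [hσ] using h ⟨σ t, by rwa [hσ]⟩
    · exact (h ⟨t, ht⟩).symm
  · exact fun h t => (h t).symm

/-- The **first fundamental theorem** for the orthogonal group: an invariant tensor is a linear
combination of the tensors of perfect matchings. -/
theorem IsOrthogonalInvariant.mem_pairingSpan {φ : (ι → A) → ℝ}
    (hφ : IsOrthogonalInvariant φ) : φ ∈ pairingSpan A (Finset.univ : Finset ι) := by
  let e := WithLp.linearEquiv 2 ℝ ((ι → A) → ℝ)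
  let W := (pairingSpan A (Finset.univ : Finset ι)).comap e.toLinearMap
  obtain ⟨w, hw, v, hv, hsum⟩ := W.exists_add_mem_mem_orthogonal (e.symm φ)
  have hwinv : IsOrthogonalInvariant (e w) := by
    have hle : pairingSpan A (Finset.univ : Finset ι) ≤
        ⨅ B ∈ Matrix.orthogonalGroup A ℝ, LinearMap.eqLocus (tensorPow ι B).mulVecLin
          LinearMap.id := by
      refine Submodule.span_le.2 ?_
      rintro _ ⟨σ, hσ, hσ', rfl⟩
      simp only [Submodule.coe_iInf, Set.mem_iInter]
      exact isOrthogonalInvariant_pairingTensor hσ fun x => (hσ' x).2 (Finset.mem_univ x)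
    have := hle hw
    simp only [Submodule.mem_iInf] at this
    exact this
  have heq : φ = e w + e v := by
    rw [← map_add, ← hsum, LinearEquiv.apply_symm_apply]
  have hvinv : IsOrthogonalInvariant (e v) := by
    intro B hB
    have := hφ B hB
    rw [heq, Matrix.mulVec_add, hwinv B hB] at this
    exact add_left_cancel this
  have hv0 : e v = 0 := hvinv.eq_zero fun u hu => by
    have := (Submodule.mem_orthogonal _ _).1 hv (e.symm u) (by simpa [W] using hu)
    simpa [EuclideanSpace.inner_eq_star_dotProduct, e] using this
  rw [heq, hv0, add_zero]
  exact hw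

end FirstFundamentalTheorem

section SymmetricTensors

open Matrix

variable {κ : Type*} {d : ℕ}

/-- The exponent vector of the monomial `∏ t, X (v t)`. -/
noncomputable def indexCount (v : Fin d → κ) : κ →₀ ℕ := ∑ t, Finsupp.single (v t) 1

theorem indexCount_degree (v : Fin d → κ) : (indexCount v).degree = d := by
  simp [indexCount, map_sum, Finsupp.degree_single]

theorem indexCount_comp (v : Fin d → κ) (e : Equiv.Perm (Fin d)) :
    indexCount (v ∘ e) = indexCount v :=
  Equiv.sum_comp e fun t => Finsupp.single (v t) 1

theorem indexCount_apply [DecidableEq κ] (v : Fin d → κ) (k : κ) :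
    indexCount v k = Fintype.card {t // v t = k} := by
  simp [indexCount, Finsupp.finsetSum_apply, Finsupp.single_apply, Fintype.card_subtype]

theorem exists_perm_of_indexCount_eq {v w : Fin d → κ} (h : indexCount v = indexCount w) :
    ∃ e : Equiv.Perm (Fin d), w ∘ e = v := by
  classical
  have hcard : ∀ k, Nonempty ({t // v t = k} ≃ {t // w t = k}) := fun k =>
    Fintype.card_eq.1 ((indexCount_apply v k).symm.trans (h ▸ indexCount_apply w k))
  exact ⟨Equiv.ofFiberEquiv fun k => (hcard k).some, funext fun t => Equiv.ofFiberEquiv_map _ t⟩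

theorem exists_indexCount_eq {α : κ →₀ ℕ} (hα : α.degree = d) :
    ∃ v : Fin d → κ, indexCount v = α := by
  subst hα
  induction α using Finsupp.induction_linear with
  | zero =>
    exact ⟨fun t => (Fin.cast (map_zero _) t).elim0,
      Finset.sum_eq_zero fun t _ => (Fin.cast (map_zero _) t).elim0⟩
  | add α β hα hβ =>
    obtain ⟨v, hv⟩ := hα
    obtain ⟨w, hw⟩ := hβ
    refine ⟨fun t => Fin.append v w (Fin.cast (map_add _ _ _) t), ?_⟩
    refine (Fintype.sum_equiv (finCongr (map_add Finsupp.degree α β)) _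
      (fun t => Finsupp.single (Fin.append v w t) 1) (fun _ => rfl)).trans ?_
    rw [Fin.sum_univ_add]
    simp only [Fin.append_left, Fin.append_right]
    exact congrArg₂ (· + ·) hv hw
  | single k n => exact ⟨fun _ => k, by simp [indexCount, Finsupp.degree_single]⟩

theorem MvPolynomial.monomial_indexCount (v : Fin d → κ) :
    MvPolynomial.monomial (indexCount v) (1 : ℝ) = ∏ t, MvPolynomial.X (v t) := by
  rw [indexCount, MvPolynomial.monomial_sum_one]
  rfl

variable [Fintype κ]

theorem MvPolynomial.coeff_sum_prod_X [DecidableEq κ] (D : ℕ)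
    (φ : ∀ d : ℕ, (Fin d → κ) → ℝ) (α : κ →₀ ℕ) :
    MvPolynomial.coeff α (∑ d ∈ Finset.range D, ∑ v : Fin d → κ,
      MvPolynomial.C (φ d v) * ∏ t, MvPolynomial.X (v t)) =
      if α.degree < D then
        ∑ v : Fin α.degree → κ with indexCount v = α, φ α.degree v else 0 := by
  simp only [← MvPolynomial.monomial_indexCount, MvPolynomial.coeff_sum,
    MvPolynomial.coeff_C_mul, MvPolynomial.coeff_monomial, mul_ite, mul_one, mul_zero]
  split_ifs with h
  · rw [Finset.sum_eq_single_of_mem α.degree (Finset.mem_range.2 h), Finset.sum_filter]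
    intro d _ hd
    refine Finset.sum_eq_zero fun v _ => if_neg ?_
    rintro rfl
    exact hd (indexCount_degree v).symm
  · refine Finset.sum_eq_zero fun d hd => Finset.sum_eq_zero fun v _ => if_neg ?_
    rintro rfl
    rw [indexCount_degree] at h
    exact h (Finset.mem_range.1 hd)

theorem eq_zero_of_sum_prod_eq_zero (D : ℕ) (φ : ∀ d : ℕ, (Fin d → κ) → ℝ)
    (hsymm : ∀ d v (e : Equiv.Perm (Fin d)), φ d (v ∘ e) = φ d v)
    (hφ : ∀ x : κ → ℝ, ∑ d ∈ Finset.range D, ∑ v : Fin d → κ, φ d v * ∏ t, x (v t) = 0)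
    {d : ℕ} (hd : d < D) : φ d = 0 := by
  classical
  have hpoly : (∑ d ∈ Finset.range D, ∑ v : Fin d → κ,
      MvPolynomial.C (φ d v) * ∏ t, MvPolynomial.X (v t)) = (0 : MvPolynomial κ ℝ) := by
    refine MvPolynomial.funext fun x => ?_
    simpa [MvPolynomial.eval_prod] using hφ x
  funext v
  obtain ⟨α, hα⟩ : ∃ α, α = indexCount v := ⟨_, rfl⟩
  have hdeg : α.degree = d := by rw [hα, indexCount_degree]
  subst hdeg
  have h := MvPolynomial.coeff_sum_prod_X D φ α
  rw [hpoly, MvPolynomial.coeff_zero, if_pos hd, Finset.sum_congr rfl (g := fun _ => φ _ v),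
    Finset.sum_const, nsmul_eq_mul, eq_comm, mul_eq_zero] at h
  · refine h.resolve_left ?_
    exact_mod_cast Finset.card_ne_zero_of_mem (a := v) (by simp [← hα])
  · intro w hw
    obtain ⟨e, rfl⟩ := exists_perm_of_indexCount_eq ((Finset.mem_filter.1 hw).2.trans hα)
    exact hsymm _ v e

theorem sum_vecMul_tensorPow_mul_prod (h : Matrix κ κ ℝ) (φ : (Fin d → κ) → ℝ) (x : κ → ℝ) :
    ∑ v, (φ ᵥ* tensorPow (Fin d) h) v * ∏ t, x (v t) = ∑ v, φ v * ∏ t, (h *ᵥ x) (v t) := by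
  simp only [Matrix.vecMul, Matrix.mulVec, dotProduct, Fintype.prod_sum, Finset.sum_mul,
    Finset.mul_sum, tensorPow_apply, Finset.prod_mul_distrib]
  rw [Finset.sum_comm]
  simp only [mul_assoc]

/-- A polynomial is given by a family of symmetric tensors, which is fixed by every linear
substitution fixing the polynomial. -/
theorem MvPolynomial.exists_tensors (f : MvPolynomial κ ℝ) :
    ∃ (D : ℕ) (φ : ∀ d : ℕ, (Fin d → κ) → ℝ),
      (∀ x, MvPolynomial.eval x f =
        ∑ d ∈ Finset.range D, ∑ v : Fin d → κ, φ d v * ∏ t, x (v t)) ∧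
      ∀ h : Matrix κ κ ℝ,
        (∀ x, MvPolynomial.eval (h *ᵥ x) f = MvPolynomial.eval x f) →
          ∀ d < D, φ d ᵥ* tensorPow (Fin d) h = φ d := by
  classical
  let φ : ∀ d : ℕ, (Fin d → κ) → ℝ := fun d v =>
    f.coeff (indexCount v) / (Finset.univ.filter
      fun w : Fin d → κ => indexCount w = indexCount v).card
  have hsymm : ∀ d v (e : Equiv.Perm (Fin d)), φ d (v ∘ e) = φ d v := fun d v e => by
    simp only [φ, indexCount_comp]
  have hf : f = ∑ d ∈ Finset.range (f.totalDegree + 1), ∑ v : Fin d → κ,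
      MvPolynomial.C (φ d v) * ∏ t, MvPolynomial.X (v t) := by
    ext α
    rw [MvPolynomial.coeff_sum_prod_X]
    split_ifs with hα
    · obtain ⟨v₀, hv₀⟩ := exists_indexCount_eq (rfl : α.degree = α.degree)
      rw [Finset.sum_congr rfl (g := fun _ => f.coeff α / (Finset.univ.filter
        fun w : Fin α.degree → κ => indexCount w = α).card), Finset.sum_const, nsmul_eq_mul,
        mul_div_cancel₀]
      · exact_mod_cast Finset.card_ne_zero_of_mem (a := v₀) (by simp [hv₀])
      · intro v hv
        simp only [φ, (Finset.mem_filter.1 hv).2]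
    · refine MvPolynomial.coeff_eq_zero_of_totalDegree_lt ?_
      rw [Finsupp.degree_apply] at hα
      omega
  have heval : ∀ x, MvPolynomial.eval x f = ∑ d ∈ Finset.range (f.totalDegree + 1),
      ∑ v : Fin d → κ, φ d v * ∏ t, x (v t) := fun x => by
    conv_lhs => rw [hf]
    simp
  refine ⟨f.totalDegree + 1, φ, heval, fun h hh d hd => sub_eq_zero.1 ?_⟩
  refine eq_zero_of_sum_prod_eq_zero (f.totalDegree + 1)
    (fun d => φ d ᵥ* tensorPow (Fin d) h - φ d) (fun d v e => ?_) (fun x => ?_) hd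
  · simp only [Pi.sub_apply, hsymm]
    congr 1
    simp only [Matrix.vecMul, dotProduct, tensorPow_apply]
    rw [← Equiv.sum_comp (Equiv.arrowCongr e.symm (Equiv.refl κ))]
    refine Finset.sum_congr rfl fun w _ => ?_
    have hw : (Equiv.arrowCongr e.symm (Equiv.refl κ)) w = w ∘ e := by
      ext; simp [Equiv.arrowCongr]
    rw [hw, hsymm]
    congr 1
    exact Equiv.prod_comp e fun t => h (w t) (v t)
  · have := hh x
    rw [heval, heval] at this
    simp only [Pi.sub_apply, sub_mul, Finset.sum_sub_distrib, sum_vecMul_tensorPow_mul_prod]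
    rw [this, sub_self]

end SymmetricTensors

section ThreeFactors

variable {X Y Z M : Type*} [Fintype X] [Fintype Y] [Fintype Z] [AddCommGroup M] [Module ℝ M]

theorem sum_smul_mem_of_mem_span {s : Set (X → ℝ)} {N : Submodule ℝ M} (m : X → M)
    (hs : ∀ u ∈ s, ∑ a, u a • m a ∈ N) {u : X → ℝ} (hu : u ∈ Submodule.span ℝ s) :
    ∑ a, u a • m a ∈ N :=
  (Submodule.span_le (p := N.comap (Fintype.linearCombination ℝ m))).2 hs hu

theorem exists_kernel_of_submodule (U : Submodule ℝ (X → ℝ)) :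
    ∃ K : X → X → ℝ, (∀ a', (fun a => K a a') ∈ U) ∧ ∀ u ∈ U, ∀ a, u a = ∑ a', K a a' * u a' := by
  classical
  obtain ⟨g, hg⟩ := LinearMap.exists_leftInverse_of_injective U.subtype U.ker_subtype
  let K := LinearMap.toMatrix' (U.subtype ∘ₗ g)
  refine ⟨K, fun a' => ?_, fun u hu a => ?_⟩
  · have : (fun a => K a a') = U.subtype (g (Pi.single a' 1)) := by
      funext a
      simp [K, LinearMap.toMatrix'_apply]
    rw [this]
    exact (g _).2
  · have h1 : g u = ⟨u, hu⟩ := LinearMap.congr_fun hg ⟨u, hu⟩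
    have h2 : K.mulVec u = u := by
      rw [← Matrix.toLin'_apply, Matrix.toLin'_toMatrix']
      simp [h1]
    exact (congrFun h2 a).symm

theorem sum_smul_mem_of_slices_mem_span {s : Set (X → ℝ)} {s' : Set (Y → ℝ)} {s'' : Set (Z → ℝ)}
    {N : Submodule ℝ M} (m : X → Y → Z → M)
    (hN : ∀ u ∈ s, ∀ v ∈ s', ∀ w ∈ s'', ∑ a, ∑ b, ∑ c, (u a * v b * w c) • m a b c ∈ N)
    (Φ : X → Y → Z → ℝ) (h1 : ∀ b c, (fun a => Φ a b c) ∈ Submodule.span ℝ s)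
    (h2 : ∀ a c, (fun b => Φ a b c) ∈ Submodule.span ℝ s')
    (h3 : ∀ a b, (fun c => Φ a b c) ∈ Submodule.span ℝ s'') :
    ∑ a, ∑ b, ∑ c, Φ a b c • m a b c ∈ N := by
  have hspan : ∀ u ∈ Submodule.span ℝ s, ∀ v ∈ Submodule.span ℝ s', ∀ w ∈ Submodule.span ℝ s'',
      ∑ a, ∑ b, ∑ c, (u a * v b * w c) • m a b c ∈ N := by
    intro u hu v hv w hw
    have hX : ∀ u : X → ℝ, ∀ v : Y → ℝ, ∀ w : Z → ℝ,
        ∑ a, ∑ b, ∑ c, (u a * v b * w c) • m a b c =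
          ∑ a, u a • ∑ b, ∑ c, (v b * w c) • m a b c := fun u v w => by
      simp only [Finset.smul_sum, smul_smul, mul_assoc]
    have hY : ∀ u : X → ℝ, ∀ v : Y → ℝ, ∀ w : Z → ℝ,
        ∑ a, ∑ b, ∑ c, (u a * v b * w c) • m a b c =
          ∑ b, v b • ∑ a, ∑ c, (u a * w c) • m a b c := fun u v w => by
      rw [Finset.sum_comm]
      simp only [Finset.smul_sum, smul_smul, mul_left_comm, mul_assoc]
    have hZ : ∀ u : X → ℝ, ∀ v : Y → ℝ, ∀ w : Z → ℝ,
        ∑ a, ∑ b, ∑ c, (u a * v b * w c) • m a b c =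
          ∑ c, w c • ∑ a, ∑ b, (u a * v b) • m a b c := fun u v w => by
      rw [Finset.sum_congr rfl fun a _ => Finset.sum_comm, Finset.sum_comm]
      simp only [Finset.smul_sum, smul_smul, mul_comm (w _)]
    rw [hX]
    refine sum_smul_mem_of_mem_span _ (fun u hu => ?_) hu
    rw [← hX, hY]
    refine sum_smul_mem_of_mem_span _ (fun v hv => ?_) hv
    rw [← hY, hZ]
    refine sum_smul_mem_of_mem_span _ (fun w hw => ?_) hw
    rw [← hZ]
    exact hN u hu v hv w hw
  obtain ⟨K₁, hK₁, hK₁'⟩ := exists_kernel_of_submodule (Submodule.span ℝ s)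
  obtain ⟨K₂, hK₂, hK₂'⟩ := exists_kernel_of_submodule (Submodule.span ℝ s')
  obtain ⟨K₃, hK₃, hK₃'⟩ := exists_kernel_of_submodule (Submodule.span ℝ s'')
  have hΦ : ∀ a b c, Φ a b c = ∑ x : X × Y × Z,
      Φ x.1 x.2.1 x.2.2 * (K₁ a x.1 * K₂ b x.2.1 * K₃ c x.2.2) := by
    intro a b c
    rw [hK₁' _ (h1 b c) a]
    simp only [Fintype.sum_prod_type]
    refine Finset.sum_congr rfl fun a' _ => ?_
    rw [hK₂' _ (h2 a' c) b, Finset.mul_sum]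
    refine Finset.sum_congr rfl fun b' _ => ?_
    rw [hK₃' _ (h3 a' b') c, Finset.mul_sum, Finset.mul_sum]
    exact Finset.sum_congr rfl fun c' _ => by ring
  have : ∑ a, ∑ b, ∑ c, Φ a b c • m a b c = ∑ x : X × Y × Z, Φ x.1 x.2.1 x.2.2 •
      ∑ a, ∑ b, ∑ c, (K₁ a x.1 * K₂ b x.2.1 * K₃ c x.2.2) • m a b c := by
    have hm : ∀ a b c, Φ a b c • m a b c = ∑ x : X × Y × Z, (Φ x.1 x.2.1 x.2.2 *
        (K₁ a x.1 * K₂ b x.2.1 * K₃ c x.2.2)) • m a b c := fun a b c => by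
      rw [hΦ, Finset.sum_smul]
    simp only [hm, Finset.smul_sum, smul_smul]
    rw [Finset.sum_comm (s := (Finset.univ : Finset (X × Y × Z)))]
    refine Finset.sum_congr rfl fun a _ => ?_
    rw [Finset.sum_comm (s := (Finset.univ : Finset (X × Y × Z)))]
    exact Finset.sum_congr rfl fun b _ => Finset.sum_comm
  rw [this]
  exact N.sum_mem fun x _ => N.smul_mem _ (hspan _ (hK₁ _) _ (hK₂ _) _ (hK₃ _))

end ThreeFactors

section Diagrams

variable {ι ι' A B C : Type*} [Fintype ι] [Fintype ι'] [Fintype A] [Fintype B] [Fintype C]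
  [DecidableEq ι]

theorem sum_arrow_prod {M : Type*} [AddCommMonoid M]
    (F : (ι → A × B × C) → M) :
    ∑ v, F v = ∑ a : ι → A, ∑ b : ι → B, ∑ c : ι → C, F fun t => (a t, b t, c t) := by
  simp only [← Fintype.sum_prod_type']
  refine Fintype.sum_equiv ((Equiv.arrowProdEquivProdArrow _ _ _).trans
    ((Equiv.refl _).prodCongr (Equiv.arrowProdEquivProdArrow _ _ _))) _ _ fun v => rfl

variable [DecidableEq ι'] [DecidableEq A] [DecidableEq B] [DecidableEq C]

/-- The invariant of a triple of permutations of an arbitrary finite vertex set. -/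
noncomputable def contraction (σ τ ρ : Equiv.Perm ι) (T : A → B → C → ℝ) : ℝ :=
  ∑ v : ι → A × B × C, if ∀ x, (v (σ x)).1 = (v x).1 ∧ (v (τ x)).2.1 = (v x).2.1 ∧
    (v (ρ x)).2.2 = (v x).2.2 then ∏ x, T (v x).1 (v x).2.1 (v x).2.2 else 0

theorem diagramInvariant_eq_sum (p q r d : ℕ) (σ τ ρ : Equiv.Perm (Fin d))
    (T : Fin p → Fin q → Fin r → ℝ) :
    diagramInvariant p q r d σ τ ρ T = ∑ a, ∑ b, ∑ c,
      (pairingTensor (Fin p) σ a * pairingTensor (Fin q) τ b * pairingTensor (Fin r) ρ c) *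
        ∏ t, T (a t) (b t) (c t) := by
  simp only [diagramInvariant, Finset.sum_filter, pairingTensor]
  refine Finset.sum_congr rfl fun a _ => ?_
  split_ifs
  · refine Finset.sum_congr rfl fun b _ => ?_
    split_ifs <;> simp
  · simp

theorem diagramInvariant_eq_contraction (p q r d : ℕ) (σ τ ρ : Equiv.Perm (Fin d)) :
    diagramInvariant p q r d σ τ ρ = contraction σ τ ρ := by
  funext T
  rw [diagramInvariant_eq_sum, contraction, sum_arrow_prod]
  refine Finset.sum_congr rfl fun a _ => Finset.sum_congr rfl fun b _ =>
    Finset.sum_congr rfl fun c _ => ?_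
  simp only [pairingTensor, forall_and, funext_iff, Function.comp]
  by_cases h1 : ∀ x, a (σ x) = a x <;> by_cases h2 : ∀ x, b (τ x) = b x <;>
    by_cases h3 : ∀ x, c (ρ x) = c x <;> simp [h1, h2, h3]

theorem contraction_permCongr (e : ι ≃ ι') (σ τ ρ : Equiv.Perm ι) :
    contraction (A := A) (B := B) (C := C) (e.permCongr σ) (e.permCongr τ) (e.permCongr ρ) =
      contraction σ τ ρ := by
  funext T
  refine (Fintype.sum_equiv (e.arrowCongr (Equiv.refl _)) _ _ fun v => ?_).symm
  simp only [Equiv.arrowCongr_apply, Equiv.coe_refl, Function.comp,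
    Equiv.permCongr_apply, Equiv.symm_apply_apply]
  congr 1
  · rw [eq_iff_iff]
    exact e.symm.forall_congr_right (q := fun x => (v (σ x)).1 = (v x).1 ∧
      (v (τ x)).2.1 = (v x).2.1 ∧ (v (ρ x)).2.2 = (v x).2.2) |>.symm
  · exact (Equiv.prod_comp e.symm fun x => T (v x).1 (v x).2.1 (v x).2.2).symm

theorem contraction_eq_mul (P : ι → Prop) [DecidablePred P] {σ τ ρ : Equiv.Perm ι}
    (hσ : ∀ x, P (σ x) ↔ P x) (hτ : ∀ x, P (τ x) ↔ P x) (hρ : ∀ x, P (ρ x) ↔ P x) :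
    contraction (A := A) (B := B) (C := C) σ τ ρ =
      contraction (σ.subtypePerm hσ) (τ.subtypePerm hτ) (ρ.subtypePerm hρ) *
        contraction (σ.subtypePerm (p := fun x => ¬ P x) fun x => not_congr (hσ x))
          (τ.subtypePerm (p := fun x => ¬ P x) fun x => not_congr (hτ x))
          (ρ.subtypePerm (p := fun x => ¬ P x) fun x => not_congr (hρ x)) := by
  funext T
  simp only [Pi.mul_apply, contraction]
  rw [Fintype.sum_mul_sum, ← Fintype.sum_prod_type']
  refine Fintype.sum_equiv (Equiv.piEquivPiSubtypeProd P fun _ => A × B × C) _ _ fun v => ?_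
  simp only [Equiv.piEquivPiSubtypeProd_apply, Equiv.Perm.subtypePerm_apply, ite_zero_mul_ite_zero]
  congr 1
  · rw [eq_iff_iff]
    refine ⟨fun h => ⟨fun x => h x, fun x => h x⟩, fun h x => ?_⟩
    by_cases hx : P x
    · exact h.1 ⟨x, hx⟩
    · exact h.2 ⟨x, hx⟩
  · exact (Fintype.prod_subtype_mul_prod_subtype P
      fun x => T (v x).1 (v x).2.1 (v x).2.2).symm

/-- The algebra generated by the invariants of connected colored Brauer diagrams. -/
noncomputable def connectedAlgebra (p q r : ℕ) :
    Subalgebra ℝ ((Fin p → Fin q → Fin r → ℝ) → ℝ) :=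
  Algebra.adjoin ℝ
    {g : (Fin p → Fin q → Fin r → ℝ) → ℝ |
      ∃ (d : ℕ) (σ τ ρ : Equiv.Perm (Fin d)),
        IsBrauerDiagram σ ∧ IsBrauerDiagram τ ∧ IsBrauerDiagram ρ ∧
          IsConnectedDiagram σ τ ρ ∧ g = diagramInvariant p q r d σ τ ρ}

theorem contraction_mem_connectedAlgebra (p q r : ℕ) (n : ℕ) :
    ∀ (ι : Type) [Fintype ι] [DecidableEq ι] (σ τ ρ : Equiv.Perm ι), Fintype.card ι = n →
      ((∀ x, σ (σ x) = x) ∧ ∀ x, σ x ≠ x) → ((∀ x, τ (τ x) = x) ∧ ∀ x, τ x ≠ x) →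
      ((∀ x, ρ (ρ x) = x) ∧ ∀ x, ρ x ≠ x) →
      contraction σ τ ρ ∈ connectedAlgebra p q r := by
  classical
  induction n using Nat.strong_induction_on with
  | _ n ih =>
    intro ι _ _ σ τ ρ hn hσ hτ hρ
    let e : ι ≃ Fin n := Fintype.equivFinOfCardEq hn
    have hconj : ∀ {π : Equiv.Perm ι}, ((∀ x, π (π x) = x) ∧ ∀ x, π x ≠ x) →
        IsBrauerDiagram (e.permCongr π) := fun {π} hπ =>
      ⟨fun x => by simp [hπ.1], fun x h => hπ.2 (e.symm x) (by
        rw [Equiv.permCongr_apply] at h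
        rw [← e.apply_eq_iff_eq, h, e.apply_symm_apply])⟩
    rw [← contraction_permCongr e]
    replace hσ := hconj hσ
    replace hτ := hconj hτ
    replace hρ := hconj hρ
    generalize e.permCongr σ = σ at *
    generalize e.permCongr τ = τ at *
    generalize e.permCongr ρ = ρ at *
    by_cases hc : IsConnectedDiagram σ τ ρ
    · exact Algebra.subset_adjoin ⟨n, σ, τ, ρ, hσ, hτ, hρ, hc,
        (diagramInvariant_eq_contraction p q r n σ τ ρ).symm⟩
    rcases n.eq_zero_or_pos with rfl | hpos
    · convert (connectedAlgebra p q r).one_mem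
      funext T
      simp [contraction]
    let G : SimpleGraph (Fin n) :=
      SimpleGraph.fromRel fun x y => σ x = y ∨ τ x = y ∨ ρ x = y
    have : Nonempty (Fin n) := ⟨⟨0, hpos⟩⟩
    have hpre : ¬ G.Preconnected := fun h => hc ⟨h⟩
    obtain ⟨x, y, hxy⟩ : ∃ x y, ¬ G.Reachable x y := by
      simpa [SimpleGraph.Preconnected] using hpre
    have hstep : ∀ π : Equiv.Perm (Fin n), (∀ z, π z ≠ z) →
        (∀ z, σ z = π z ∨ τ z = π z ∨ ρ z = π z) →
        ∀ z, G.Reachable x (π z) ↔ G.Reachable x z := by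
      intro π hπ h z
      have hadj : G.Adj z (π z) := by
        rw [SimpleGraph.fromRel_adj]
        exact ⟨(hπ z).symm, Or.inl (h z)⟩
      exact ⟨fun h => h.trans hadj.symm.reachable, fun h => h.trans hadj.reachable⟩
    have hsub : ∀ {P : Fin n → Prop} {π : Equiv.Perm (Fin n)} (hP : ∀ z, P (π z) ↔ P z),
        IsBrauerDiagram π → ((∀ z, π.subtypePerm hP (π.subtypePerm hP z) = z) ∧
          ∀ z, π.subtypePerm hP z ≠ z) := fun hP hπ =>
      ⟨fun z => Subtype.ext (hπ.1 z), fun z h => hπ.2 z (congrArg Subtype.val h)⟩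
    rw [contraction_eq_mul (fun z => G.Reachable x z) (hstep σ hσ.2 (by simp))
      (hstep τ hτ.2 (by simp)) (hstep ρ hρ.2 (by simp))]
    refine mul_mem (ih _ ?_ _ _ _ _ rfl (hsub _ hσ) (hsub _ hτ) (hsub _ hρ))
      (ih _ ?_ _ _ _ _ rfl (hsub _ hσ) (hsub _ hτ) (hsub _ hρ))
    · conv_rhs => rw [← Fintype.card_fin n]
      exact Fintype.card_subtype_lt hxy
    · conv_rhs => rw [← Fintype.card_fin n]
      exact Fintype.card_subtype_lt (x := x) (by simp)

end Diagrams

theorem isOrthogonalInvariant_of_vecMul {ι A : Type*} [Fintype ι] [Fintype A] [DecidableEq A]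
    [DecidableEq ι] {φ : (ι → A) → ℝ}
    (h : ∀ B ∈ Matrix.orthogonalGroup A ℝ, Matrix.vecMul φ (tensorPow ι B) = φ) :
    IsOrthogonalInvariant φ := by
  intro B hB
  have := h B.transpose (by
    rw [Matrix.mem_orthogonalGroup_iff, Matrix.transpose_transpose]
    exact (Matrix.mem_orthogonalGroup_iff' _ _).1 hB)
  rwa [tensorPow_transpose, Matrix.vecMul_transpose] at this

theorem pairingSpan_univ_eq {d : ℕ} (A : Type*) [DecidableEq A] :
    pairingSpan A (Finset.univ : Finset (Fin d)) =
      Submodule.span ℝ {w | ∃ σ : Equiv.Perm (Fin d), IsBrauerDiagram σ ∧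
        w = pairingTensor A σ} := by
  simp [pairingSpan, IsBrauerDiagram, and_assoc]

section Kronecker

open Matrix Kronecker

variable {ι A B C : Type*} [Fintype ι] [DecidableEq ι] [Fintype A] [Fintype B] [Fintype C]

theorem vecMul_tensorPow_kronecker (φ : (ι → A × B × C) → ℝ) (M : Matrix A A ℝ)
    (N : Matrix B B ℝ) (L : Matrix C C ℝ) (a : ι → A) (b : ι → B) (c : ι → C) :
    (φ ᵥ* tensorPow ι (M ⊗ₖ (N ⊗ₖ L))) (fun t => (a t, b t, c t)) =
      ∑ a', ∑ b', ∑ c', φ (fun t => (a' t, b' t, c' t)) *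
        (tensorPow ι M a' a * (tensorPow ι N b' b * tensorPow ι L c' c)) := by
  simp only [Matrix.vecMul, dotProduct]
  rw [sum_arrow_prod]
  simp only [tensorPow_apply, Matrix.kroneckerMap_apply, Finset.prod_mul_distrib]

end Kronecker

open Matrix Kronecker in
theorem stmt_8 (p q r : ℕ) (hp : 1 ≤ p) (hq : 1 ≤ q) (hr : 1 ≤ r)
    (f : MvPolynomial (Fin p × Fin q × Fin r) ℝ)
    (hinv : ∀ B ∈ Matrix.orthogonalGroup (Fin p) ℝ, ∀ C ∈ Matrix.orthogonalGroup (Fin q) ℝ,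
      ∀ D ∈ Matrix.orthogonalGroup (Fin r) ℝ, ∀ T : Fin p → Fin q → Fin r → ℝ,
        MvPolynomial.eval (fun v => actTensor p q r B C D T v.1 v.2.1 v.2.2) f =
          MvPolynomial.eval (fun v => T v.1 v.2.1 v.2.2) f) :
    (fun T : Fin p → Fin q → Fin r → ℝ => MvPolynomial.eval (fun v => T v.1 v.2.1 v.2.2) f) ∈
      Algebra.adjoin ℝ
        {g : (Fin p → Fin q → Fin r → ℝ) → ℝ |
          ∃ (d : ℕ) (σ τ ρ : Equiv.Perm (Fin d)),
            IsBrauerDiagram σ ∧ IsBrauerDiagram τ ∧ IsBrauerDiagram ρ ∧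
              IsConnectedDiagram σ τ ρ ∧ g = diagramInvariant p q r d σ τ ρ} := by
  obtain ⟨D, φ, hf, hφ⟩ := MvPolynomial.exists_tensors f
  have hinv' : ∀ M ∈ Matrix.orthogonalGroup (Fin p) ℝ, ∀ N ∈ Matrix.orthogonalGroup (Fin q) ℝ,
      ∀ L ∈ Matrix.orthogonalGroup (Fin r) ℝ, ∀ d < D,
        φ d ᵥ* tensorPow (Fin d) (M ⊗ₖ (N ⊗ₖ L)) = φ d := by
    intro M hM N hN L hL
    refine hφ _ fun x => ?_
    convert hinv M hM N hN L hL (fun i j k => x (i, j, k)) using 2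
    congr 1
    funext v
    simp only [Matrix.mulVec, dotProduct, actTensor, Fintype.sum_prod_type,
      Matrix.kroneckerMap_apply, mul_assoc]
  have hmem : ∀ d < D, (∑ a : Fin d → Fin p, ∑ b : Fin d → Fin q, ∑ c : Fin d → Fin r,
      φ d (fun t => (a t, b t, c t)) •
      (fun T : Fin p → Fin q → Fin r → ℝ => ∏ t : Fin d, T (a t) (b t) (c t))) ∈
        Subalgebra.toSubmodule (connectedAlgebra p q r) := by
    intro d hd
    refine sum_smul_mem_of_slices_mem_span
      (s := {w | ∃ σ : Equiv.Perm (Fin d), IsBrauerDiagram σ ∧ w = pairingTensor (Fin p) σ})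
      (s' := {w | ∃ σ : Equiv.Perm (Fin d), IsBrauerDiagram σ ∧ w = pairingTensor (Fin q) σ})
      (s'' := {w | ∃ σ : Equiv.Perm (Fin d), IsBrauerDiagram σ ∧ w = pairingTensor (Fin r) σ})
      (fun a b c (T : Fin p → Fin q → Fin r → ℝ) => ∏ t : Fin d, T (a t) (b t) (c t)) ?_
      (fun a b c => φ d fun t => (a t, b t, c t)) ?_ ?_ ?_
    · rintro _ ⟨σ, hσ, rfl⟩ _ ⟨τ, hτ, rfl⟩ _ ⟨ρ, hρ, rfl⟩
      have := contraction_mem_connectedAlgebra p q r d (Fin d) σ τ ρ (Fintype.card_fin d) hσ hτ hρ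
      rw [← diagramInvariant_eq_contraction] at this
      rw [Subalgebra.mem_toSubmodule]
      convert this using 1
      funext T
      simp only [diagramInvariant_eq_sum, Finset.sum_apply, Pi.smul_apply, smul_eq_mul]
    · intro b c
      rw [← pairingSpan_univ_eq]
      refine (isOrthogonalInvariant_of_vecMul fun M hM => ?_).mem_pairingSpan
      funext a
      have := congrFun (hinv' M hM 1 (one_mem _) 1 (one_mem _) d hd) fun t => (a t, b t, c t)
      rw [vecMul_tensorPow_kronecker] at this
      simpa [tensorPow_one, Matrix.one_apply, Matrix.vecMul, dotProduct] using this
    · intro a c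
      rw [← pairingSpan_univ_eq]
      refine (isOrthogonalInvariant_of_vecMul fun M hM => ?_).mem_pairingSpan
      funext b
      have := congrFun (hinv' 1 (one_mem _) M hM 1 (one_mem _) d hd) fun t => (a t, b t, c t)
      rw [vecMul_tensorPow_kronecker] at this
      simpa [tensorPow_one, Matrix.one_apply, Matrix.vecMul, dotProduct] using this
    · intro a b
      rw [← pairingSpan_univ_eq]
      refine (isOrthogonalInvariant_of_vecMul fun M hM => ?_).mem_pairingSpan
      funext c
      have := congrFun (hinv' 1 (one_mem _) 1 (one_mem _) M hM d hd) fun t => (a t, b t, c t)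
      rw [vecMul_tensorPow_kronecker] at this
      simpa [tensorPow_one, Matrix.one_apply, Matrix.vecMul, dotProduct] using this
  change _ ∈ Subalgebra.toSubmodule (connectedAlgebra p q r)
  convert (Subalgebra.toSubmodule (connectedAlgebra p q r)).sum_mem
    (t := Finset.range D) fun d hd => hmem d (Finset.mem_range.1 hd) using 1
  funext T
  rw [hf, Finset.sum_apply]
  refine Finset.sum_congr rfl fun d _ => ?_
  rw [sum_arrow_prod]
  simp only [Finset.sum_apply, Pi.smul_apply, smul_eq_mul]
end

section
/- Let p, q, r ≥ 1, let μ be the product of the uniform probability measures on the unit spheres S^{p−1} ⊂ ℝ^p, S^{q−1} ⊂ ℝ^q and S^{r−1} ⊂ ℝ^r, and let T : Fin p → Fin q → Fin r → ℝ be a 3-way tensor. Then ∫_{S^{p−1}×S^{q−1}×S^{r−1}} (Σ_{i,j,k} T(i,j,k) x(i) y(j) z(k))² dμ(x,y,z) = ‖T‖² / (pqr), where ‖T‖² = Σ_{i,j,k} T(i,j,k)². Equivalently, the degree-2 approximation ‖·‖_{σ,2} of the spectral norm equals the Euclidean (Frobenius) norm. -/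
open MeasureTheory

/-- A finite family of real random variables is isotropic with second moment `c` when its matrix of
mixed second moments exists and equals `c` times the identity. -/
def IsIsotropicFamily {ι Ω : Type*} [DecidableEq ι] [MeasurableSpace Ω] (μ : Measure Ω)
    (f : ι → Ω → ℝ) (c : ℝ) : Prop :=
  ∀ i j, Integrable (fun ω => f i ω * f j ω) μ ∧ ∫ ω, f i ω * f j ω ∂μ = if i = j then c else 0

namespace IsIsotropicFamily

variable {ι κ Ω Ω' : Type*} [DecidableEq ι] [DecidableEq κ] [MeasurableSpace Ω]
  [MeasurableSpace Ω'] {μ : Measure Ω} {ν : Measure Ω'} {f : ι → Ω → ℝ} {g : κ → Ω' → ℝ} {c d : ℝ}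

theorem prod [SFinite μ] [SFinite ν] (hf : IsIsotropicFamily μ f c)
    (hg : IsIsotropicFamily ν g d) :
    IsIsotropicFamily (μ.prod ν) (fun (i : ι × κ) ω => f i.1 ω.1 * g i.2 ω.2) (c * d) := by
  rintro ⟨i, j⟩ ⟨k, l⟩
  have key : (fun ω : Ω × Ω' => f i ω.1 * g j ω.2 * (f k ω.1 * g l ω.2)) =
      fun ω => f i ω.1 * f k ω.1 * (g j ω.2 * g l ω.2) := by
    ext ω; ring
  dsimp only
  rw [key]
  refine ⟨(hf i k).1.mul_prod (hg j l).1, ?_⟩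
  rw [integral_prod_mul (fun x => f i x * f k x) (fun y => g j y * g l y), (hf i k).2, (hg j l).2]
  by_cases hik : i = k <;> by_cases hjl : j = l <;> simp [hik, hjl]

theorem integral_sum_sq [Fintype ι] (hf : IsIsotropicFamily μ f c) (a : ι → ℝ) :
    ∫ ω, (∑ i, a i * f i ω) ^ 2 ∂μ = (∑ i, a i ^ 2) * c := by
  have key : ∀ ω, (∑ i, a i * f i ω) ^ 2 = ∑ i, ∑ j, a i * a j * (f i ω * f j ω) := fun ω => by
    rw [sq, Finset.sum_mul_sum]
    exact Finset.sum_congr rfl fun i _ => Finset.sum_congr rfl fun j _ => by ring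
  have hintegrable : ∀ i j, Integrable (fun ω => a i * a j * (f i ω * f j ω)) μ := fun i j =>
    (hf i j).1.const_mul _
  simp_rw [key]
  rw [integral_finsetSum _ fun i _ => integrable_finsetSum _ fun j _ => hintegrable i j,
    Finset.sum_mul]
  refine Finset.sum_congr rfl fun i _ => ?_
  rw [integral_finsetSum _ fun j _ => hintegrable i j]
  simp [integral_const_mul, (hf i _).2, sq]

end IsIsotropicFamily

/-- The coordinates of a random point of the unit sphere with orthogonally invariant law are
isotropic. -/
theorem isIsotropicFamily_coord_of_orthogonal_invariant {n : ℕ}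
    (μ : Measure (EuclideanSpace ℝ (Fin n))) [IsProbabilityMeasure μ]
    (hμ : μ (Metric.sphere (0 : EuclideanSpace ℝ (Fin n)) 1) = 1)
    (hinv : ∀ A ∈ Matrix.orthogonalGroup (Fin n) ℝ,
      μ.map (⇑(Matrix.toEuclideanLin A :
        EuclideanSpace ℝ (Fin n) →ₗ[ℝ] EuclideanSpace ℝ (Fin n))) = μ) :
    IsIsotropicFamily μ (fun i x => x i) (n : ℝ)⁻¹ := by
  have hnorm : ∀ᵐ x ∂μ, ‖x‖ = 1 := by
    have h := (prob_compl_eq_zero_iff Metric.isClosed_sphere.measurableSet).2 hμ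
    filter_upwards [compl_mem_ae_iff.2 h] with x hx
    simpa using hx
  have hintegrable : ∀ i j : Fin n,
      Integrable (fun x : EuclideanSpace ℝ (Fin n) => x i * x j) μ := fun i j => by
    refine Integrable.of_bound (by fun_prop) 1 ?_
    filter_upwards [hnorm] with x hx
    have hi := PiLp.norm_apply_le x i
    have hj := PiLp.norm_apply_le x j
    rw [hx] at hi hj
    rw [norm_mul]
    exact mul_le_one₀ hi (norm_nonneg _) hj
  have hchange : ∀ A ∈ Matrix.orthogonalGroup (Fin n) ℝ, ∀ i j : Fin n,
      ∫ x, (Matrix.toEuclideanLin A x) i * (Matrix.toEuclideanLin A x) j ∂μ =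
        ∫ x, x i * x j ∂μ := fun A hA i j => by
    have hmeas : Measurable (Matrix.toEuclideanLin A :
        EuclideanSpace ℝ (Fin n) →ₗ[ℝ] EuclideanSpace ℝ (Fin n)) :=
      (LinearMap.continuous_of_finiteDimensional _).measurable
    conv_rhs => rw [← hinv A hA]
    rw [integral_map hmeas.aemeasurable (by fun_prop)]
  have hoff : ∀ i j : Fin n, i ≠ j → ∫ x, x i * x j ∂μ = 0 := fun i j hij => by
    have h := hchange (Matrix.diagonal fun k => if k = i then -1 else 1) (by
      rw [Matrix.mem_orthogonalGroup_iff, Matrix.diagonal_transpose,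
        Matrix.diagonal_mul_diagonal, ← Matrix.diagonal_one]
      congr 1; ext k; by_cases hk : k = i <;> simp [hk]) i j
    simp [Matrix.toLpLin_apply, Matrix.mulVec_diagonal, hij.symm, integral_neg] at h
    linarith
  have hdiag : ∀ i j : Fin n, ∫ x, x i * x i ∂μ = ∫ x, x j * x j ∂μ := fun i j => by
    have h := hchange ((Equiv.swap i j).permMatrix ℝ) (by
      rw [Matrix.mem_orthogonalGroup_iff, Matrix.transpose_permMatrix,
        ← Matrix.permMatrix_mul]
      simp) j j
    simpa [Matrix.toLpLin_apply, Matrix.permMatrix_mulVec] using h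
  have htotal : ∑ i : Fin n, ∫ x, x i * x i ∂μ = 1 := by
    rw [← integral_finsetSum _ fun i _ => hintegrable i i]
    trans ∫ _, (1 : ℝ) ∂μ
    · refine integral_congr_ae ?_
      filter_upwards [hnorm] with x hx
      have h := EuclideanSpace.real_norm_sq_eq x
      rw [hx] at h
      simpa [sq] using h.symm
    · simp
  refine fun i j => ⟨hintegrable i j, ?_⟩
  split_ifs with hij
  · subst hij
    rw [Finset.sum_congr rfl fun j _ => hdiag j i] at htotal
    simp only [Finset.sum_const, Finset.card_univ, Fintype.card_fin, nsmul_eq_mul] at htotal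
    exact eq_inv_of_mul_eq_one_right htotal
  · exact hoff i j hij


theorem stmt_9 (p q r : ℕ) (hp : 1 ≤ p) (hq : 1 ≤ q) (hr : 1 ≤ r)
    (μp : Measure (EuclideanSpace ℝ (Fin p))) [IsProbabilityMeasure μp]
    (hμp : μp (Metric.sphere (0 : EuclideanSpace ℝ (Fin p)) 1) = 1)
    (hpinv : ∀ A ∈ Matrix.orthogonalGroup (Fin p) ℝ,
      μp.map (⇑(Matrix.toEuclideanLin A :
        EuclideanSpace ℝ (Fin p) →ₗ[ℝ] EuclideanSpace ℝ (Fin p))) = μp)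
    (μq : Measure (EuclideanSpace ℝ (Fin q))) [IsProbabilityMeasure μq]
    (hμq : μq (Metric.sphere (0 : EuclideanSpace ℝ (Fin q)) 1) = 1)
    (hqinv : ∀ A ∈ Matrix.orthogonalGroup (Fin q) ℝ,
      μq.map (⇑(Matrix.toEuclideanLin A :
        EuclideanSpace ℝ (Fin q) →ₗ[ℝ] EuclideanSpace ℝ (Fin q))) = μq)
    (μr : Measure (EuclideanSpace ℝ (Fin r))) [IsProbabilityMeasure μr]
    (hμr : μr (Metric.sphere (0 : EuclideanSpace ℝ (Fin r)) 1) = 1)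
    (hrinv : ∀ A ∈ Matrix.orthogonalGroup (Fin r) ℝ,
      μr.map (⇑(Matrix.toEuclideanLin A :
        EuclideanSpace ℝ (Fin r) →ₗ[ℝ] EuclideanSpace ℝ (Fin r))) = μr)
    (T : Fin p → Fin q → Fin r → ℝ) :
    ∫ w : EuclideanSpace ℝ (Fin p) × EuclideanSpace ℝ (Fin q) × EuclideanSpace ℝ (Fin r),
        (∑ i, ∑ j, ∑ k, T i j k * w.1 i * w.2.1 j * w.2.2 k) ^ 2 ∂(μp.prod (μq.prod μr)) =
      (∑ i, ∑ j, ∑ k, T i j k ^ 2) / (p * q * r : ℝ) := by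
  have h := ((isIsotropicFamily_coord_of_orthogonal_invariant μp hμp hpinv).prod
    ((isIsotropicFamily_coord_of_orthogonal_invariant μq hμq hqinv).prod
      (isIsotropicFamily_coord_of_orthogonal_invariant μr hμr hrinv))).integral_sum_sq
    fun i => T i.1 i.2.1 i.2.2
  simp only [Fintype.sum_prod_type] at h
  simp only [mul_assoc]
  rw [h, div_eq_mul_inv, mul_inv, mul_inv]
end

section
/- Let p, q, r ≥ 1, let μ be the product of the uniform probability measures on the unit spheres S^{p−1} ⊂ ℝ^p, S^{q−1} ⊂ ℝ^q and S^{r−1} ⊂ ℝ^r, and let T : Fin p → Fin q → Fin r → ℝ be a 3-way tensor. Then ∫_{S^{p−1}×S^{q−1}×S^{r−1}} (Σ_{i,j,k} T(i,j,k) x(i) y(j) z(k))⁴ dμ(x,y,z) = (3‖T‖⁴ + 6P₁(T) + 6P₂(T) + 6P₃(T) + 6P₄(T)) / (p(p+2)q(q+2)r(r+2)). Consequently the normalized degree-4 spectral norm approximation satisfies ‖T‖_{σ,4}⁴ = (3‖T‖⁴ + 6P₁(T) + 6P₂(T) + 6P₃(T) + 6P₄(T))/27. -/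
open MeasureTheory

/-- Squared Frobenius norm of a 3-way tensor. -/
noncomputable def frobSq {p q r : ℕ} (T : Fin p → Fin q → Fin r → ℝ) : ℝ :=
  ∑ i, ∑ j, ∑ k, T i j k ^ 2

noncomputable def P₁ {p q r : ℕ} (T : Fin p → Fin q → Fin r → ℝ) : ℝ :=
  ∑ a, ∑ b, ∑ c, ∑ d, ∑ e, ∑ f, T a c e * T a d f * T b c e * T b d f

noncomputable def P₂ {p q r : ℕ} (T : Fin p → Fin q → Fin r → ℝ) : ℝ :=
  ∑ a, ∑ b, ∑ c, ∑ d, ∑ e, ∑ f, T a c e * T a d e * T b c f * T b d f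

noncomputable def P₃ {p q r : ℕ} (T : Fin p → Fin q → Fin r → ℝ) : ℝ :=
  ∑ a, ∑ b, ∑ c, ∑ d, ∑ e, ∑ f, T a c e * T a c f * T b d e * T b d f

/-- The tetrahedron invariant. -/
noncomputable def P₄ {p q r : ℕ} (T : Fin p → Fin q → Fin r → ℝ) : ℝ :=
  ∑ a, ∑ b, ∑ c, ∑ d, ∑ e, ∑ f, T a c e * T a d f * T b d e * T b c f

/-- A continuous function is integrable against a finite measure carried by a compact set. -/
theorem integrable_of_continuous_of_compact {X : Type*} [TopologicalSpace X] [T2Space X]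
    [MeasurableSpace X] [OpensMeasurableSpace X] {μ : Measure X} [IsFiniteMeasure μ] {K : Set X}
    (hK : IsCompact K) (hμK : ∀ᵐ x ∂μ, x ∈ K) {f : X → ℝ} (hf : Continuous f) :
    Integrable f μ := by
  have h := hf.continuousOn.integrableOn_compact (μ := μ) hK
  rwa [IntegrableOn, Measure.restrict_eq_self_of_ae_mem hμK] at h

section SphereMoments

variable {n : ℕ} {μ : Measure (EuclideanSpace ℝ (Fin n))}

theorem map_linearIsometryEquiv
    (hinv : ∀ A ∈ Matrix.orthogonalGroup (Fin n) ℝ,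
      μ.map (⇑(Matrix.toEuclideanLin A :
        EuclideanSpace ℝ (Fin n) →ₗ[ℝ] EuclideanSpace ℝ (Fin n))) = μ)
    (L : EuclideanSpace ℝ (Fin n) ≃ₗᵢ[ℝ] EuclideanSpace ℝ (Fin n)) : μ.map L = μ := by
  have hL : Matrix.toEuclideanLin (Matrix.toEuclideanLin.symm L.toLinearEquiv.toLinearMap) =
    L.toLinearEquiv.toLinearMap := LinearEquiv.apply_symm_apply _ _
  have hmem : Matrix.toEuclideanLin.symm L.toLinearEquiv.toLinearMap ∈
      Matrix.orthogonalGroup (Fin n) ℝ := by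
    set A := Matrix.toEuclideanLin.symm L.toLinearEquiv.toLinearMap
    rw [Matrix.mem_orthogonalGroup_iff']
    apply Matrix.toEuclideanLin.injective
    refine LinearMap.ext fun x => ext_inner_left ℝ fun y => ?_
    have h1 : Matrix.toEuclideanLin (A.transpose * A) =
        (Matrix.toEuclideanLin A).adjoint ∘ₗ Matrix.toEuclideanLin A := by
      rw [← Matrix.toEuclideanLin_conjTranspose_eq_adjoint,
        Matrix.conjTranspose_eq_transpose_of_trivial]
      ext; simp [Matrix.toLpLin_apply]
    have h2 : Matrix.toEuclideanLin (1 : Matrix (Fin n) (Fin n) ℝ) = LinearMap.id := by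
      ext; simp
    rw [h1, h2, LinearMap.comp_apply, LinearMap.adjoint_inner_right, hL]
    exact L.inner_map_map y x
  have := hinv _ hmem
  rw [hL] at this
  exact this

theorem integral_inner_pow_four_eq_of_norm_eq
    (hinv : ∀ A ∈ Matrix.orthogonalGroup (Fin n) ℝ,
      μ.map (⇑(Matrix.toEuclideanLin A :
        EuclideanSpace ℝ (Fin n) →ₗ[ℝ] EuclideanSpace ℝ (Fin n))) = μ)
    {u v : EuclideanSpace ℝ (Fin n)} (huv : ‖u‖ = ‖v‖) :
    ∫ x, inner ℝ u x ^ 4 ∂μ = ∫ x, inner ℝ v x ^ 4 ∂μ := by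
  set L := (ℝ ∙ (u - v))ᗮ.reflection
  have hL : L u = v := Submodule.reflection_sub huv
  have hmap := map_linearIsometryEquiv hinv L
  conv_rhs => rw [← hmap]
  rw [integral_map L.continuous.aemeasurable
    (Continuous.aestronglyMeasurable (by fun_prop)), ← hL]
  simp [L.inner_map_map]

theorem exists_integral_inner_pow_four (hn : 1 ≤ n)
    (hinv : ∀ A ∈ Matrix.orthogonalGroup (Fin n) ℝ,
      μ.map (⇑(Matrix.toEuclideanLin A :
        EuclideanSpace ℝ (Fin n) →ₗ[ℝ] EuclideanSpace ℝ (Fin n))) = μ) :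
    ∃ C : ℝ, ∀ u : EuclideanSpace ℝ (Fin n),
      ∫ x, inner ℝ u x ^ 4 ∂μ = C * inner ℝ u u ^ 2 := by
  set e : EuclideanSpace ℝ (Fin n) := EuclideanSpace.single ⟨0, hn⟩ 1
  refine ⟨∫ x, inner ℝ e x ^ 4 ∂μ, fun u => ?_⟩
  have h : ‖u‖ = ‖‖u‖ • e‖ := by simp [norm_smul, e]
  rw [integral_inner_pow_four_eq_of_norm_eq hinv h, real_inner_self_eq_norm_sq]
  simp only [real_inner_smul_left, mul_pow, integral_const_mul]
  ring

variable [IsProbabilityMeasure μ]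

theorem ae_mem_sphere (hμ : μ (Metric.sphere (0 : EuclideanSpace ℝ (Fin n)) 1) = 1) :
    ∀ᵐ x ∂μ, x ∈ Metric.sphere (0 : EuclideanSpace ℝ (Fin n)) 1 := by
  rwa [← prob_compl_eq_zero_iff Metric.isClosed_sphere.measurableSet] at hμ

theorem integrable_of_sphere (hμ : μ (Metric.sphere (0 : EuclideanSpace ℝ (Fin n)) 1) = 1)
    {f : EuclideanSpace ℝ (Fin n) → ℝ} (hf : Continuous f) : Integrable f μ :=
  integrable_of_continuous_of_compact (isCompact_sphere 0 1) (ae_mem_sphere hμ) hf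

theorem integral_sum_of_sphere (hμ : μ (Metric.sphere (0 : EuclideanSpace ℝ (Fin n)) 1) = 1)
    {ι : Type*} [Fintype ι] {f : ι → EuclideanSpace ℝ (Fin n) → ℝ} (hf : ∀ i, Continuous (f i)) :
    ∫ x, ∑ i, f i x ∂μ = ∑ i, ∫ x, f i x ∂μ :=
  integral_finsetSum _ fun i _ => integrable_of_sphere hμ (hf i)

theorem exists_integral_inner_mul_four (hn : 1 ≤ n)
    (hμ : μ (Metric.sphere (0 : EuclideanSpace ℝ (Fin n)) 1) = 1)
    (hinv : ∀ A ∈ Matrix.orthogonalGroup (Fin n) ℝ,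
      μ.map (⇑(Matrix.toEuclideanLin A :
        EuclideanSpace ℝ (Fin n) →ₗ[ℝ] EuclideanSpace ℝ (Fin n))) = μ) :
    ∃ C : ℝ, ∀ u v w t : EuclideanSpace ℝ (Fin n),
      ∫ x, inner ℝ u x * inner ℝ v x * inner ℝ w x * inner ℝ t x ∂μ =
        C * (inner ℝ u v * inner ℝ w t + inner ℝ u w * inner ℝ v t +
          inner ℝ u t * inner ℝ v w) := by
  obtain ⟨C, hC⟩ := exists_integral_inner_pow_four hn hinv
  refine ⟨C / 3, fun u v w t => ?_⟩
  have hint (a : EuclideanSpace ℝ (Fin n)) : Integrable (fun x => inner ℝ a x ^ 4) μ :=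
    integrable_of_sphere hμ (by fun_prop)
  have polarize : ∀ x : EuclideanSpace ℝ (Fin n),
      inner ℝ u x * inner ℝ v x * inner ℝ w x * inner ℝ t x =
      1 / 192 * (inner ℝ (u + v + w + t) x ^ 4 - inner ℝ (u + v + w - t) x ^ 4
        - inner ℝ (u + v - w + t) x ^ 4 + inner ℝ (u + v - w - t) x ^ 4
        - inner ℝ (u - v + w + t) x ^ 4 + inner ℝ (u - v + w - t) x ^ 4
        + inner ℝ (u - v - w + t) x ^ 4 - inner ℝ (u - v - w - t) x ^ 4) := by
    intro x
    simp only [inner_add_left, inner_sub_left]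
    ring
  simp only [polarize]
  rw [integral_const_mul, integral_sub (by fun_prop) (by fun_prop),
    integral_add (by fun_prop) (by fun_prop), integral_add (by fun_prop) (by fun_prop),
    integral_sub (by fun_prop) (by fun_prop), integral_add (by fun_prop) (by fun_prop),
    integral_sub (by fun_prop) (by fun_prop), integral_sub (by fun_prop) (by fun_prop)]
  simp only [hC]
  simp only [inner_add_left, inner_sub_left, inner_add_right, inner_sub_right,
    real_inner_comm u v, real_inner_comm u w, real_inner_comm u t, real_inner_comm v w,
    real_inner_comm v t, real_inner_comm w t]
  ring

/-- The degree-four moments of the uniform probability measure on the unit sphere. -/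
theorem integral_inner_mul_four (hn : 1 ≤ n)
    (hμ : μ (Metric.sphere (0 : EuclideanSpace ℝ (Fin n)) 1) = 1)
    (hinv : ∀ A ∈ Matrix.orthogonalGroup (Fin n) ℝ,
      μ.map (⇑(Matrix.toEuclideanLin A :
        EuclideanSpace ℝ (Fin n) →ₗ[ℝ] EuclideanSpace ℝ (Fin n))) = μ)
    (u v w t : EuclideanSpace ℝ (Fin n)) :
    ∫ x, inner ℝ u x * inner ℝ v x * inner ℝ w x * inner ℝ t x ∂μ =
      (inner ℝ u v * inner ℝ w t + inner ℝ u w * inner ℝ v t +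
        inner ℝ u t * inner ℝ v w) / (n * (n + 2)) := by
  obtain ⟨C, hC⟩ := exists_integral_inner_mul_four hn hμ hinv
  have hn' : (0 : ℝ) < n := by exact_mod_cast hn
  let e (i : Fin n) : EuclideanSpace ℝ (Fin n) := EuclideanSpace.single i 1
  have hsum : ∫ x, ∑ i, ∑ j, inner ℝ (e i) x * inner ℝ (e i) x * inner ℝ (e j) x *
      inner ℝ (e j) x ∂μ = 1 := by
    rw [integral_congr_ae (g := fun _ => (1 : ℝ))]
    · simp
    · filter_upwards [ae_mem_sphere hμ] with x hx
      have hx' : ∑ i, x i * x i = 1 := by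
        have := EuclideanSpace.real_norm_sq_eq x
        rw [mem_sphere_zero_iff_norm.mp hx] at this
        simpa [pow_two] using this.symm
      calc _ = (∑ i, x i * x i) * ∑ j, x j * x j := by
            simp [e, EuclideanSpace.inner_single_left, Finset.sum_mul_sum, mul_assoc]
        _ = 1 := by rw [hx', one_mul]
  have hval : ∑ i, ∑ j, C * (inner ℝ (e i) (e i) * inner ℝ (e j) (e j) +
      inner ℝ (e i) (e j) * inner ℝ (e i) (e j) +
      inner ℝ (e i) (e j) * inner ℝ (e i) (e j)) = C * (n * (n + 2)) := by
    simp [e, EuclideanSpace.inner_single_left, ← Finset.mul_sum, Finset.sum_add_distrib]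
    ring
  simp (disch := fun_prop) only [integral_sum_of_sphere hμ, hC] at hsum
  rw [hval] at hsum
  rw [hC, div_eq_mul_inv, eq_inv_of_mul_eq_one_left hsum, mul_comm]

theorem integral_sum_mul_four (hn : 1 ≤ n)
    (hμ : μ (Metric.sphere (0 : EuclideanSpace ℝ (Fin n)) 1) = 1)
    (hinv : ∀ A ∈ Matrix.orthogonalGroup (Fin n) ℝ,
      μ.map (⇑(Matrix.toEuclideanLin A :
        EuclideanSpace ℝ (Fin n) →ₗ[ℝ] EuclideanSpace ℝ (Fin n))) = μ)
    (u v w t : Fin n → ℝ) :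
    ∫ x, (∑ i, u i * x i) * (∑ i, v i * x i) * (∑ i, w i * x i) * (∑ i, t i * x i) ∂μ =
      ((∑ i, u i * v i) * (∑ i, w i * t i) + (∑ i, u i * w i) * (∑ i, v i * t i) +
        (∑ i, u i * t i) * (∑ i, v i * w i)) / (n * (n + 2)) := by
  simpa [PiLp.inner_apply, mul_comm] using integral_inner_mul_four hn hμ hinv
    (WithLp.toLp 2 u) (WithLp.toLp 2 v) (WithLp.toLp 2 w) (WithLp.toLp 2 t)

end SphereMoments

/-- The fourth moment of the trilinear form of `T` over a product of three unit spheres. -/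
theorem integral_multilinear_pow_four {p q r : ℕ} (hp : 1 ≤ p) (hq : 1 ≤ q) (hr : 1 ≤ r)
    {μp : Measure (EuclideanSpace ℝ (Fin p))} [IsProbabilityMeasure μp]
    (hμp : μp (Metric.sphere (0 : EuclideanSpace ℝ (Fin p)) 1) = 1)
    (hpinv : ∀ A ∈ Matrix.orthogonalGroup (Fin p) ℝ,
      μp.map (⇑(Matrix.toEuclideanLin A :
        EuclideanSpace ℝ (Fin p) →ₗ[ℝ] EuclideanSpace ℝ (Fin p))) = μp)
    {μq : Measure (EuclideanSpace ℝ (Fin q))} [IsProbabilityMeasure μq]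
    (hμq : μq (Metric.sphere (0 : EuclideanSpace ℝ (Fin q)) 1) = 1)
    (hqinv : ∀ A ∈ Matrix.orthogonalGroup (Fin q) ℝ,
      μq.map (⇑(Matrix.toEuclideanLin A :
        EuclideanSpace ℝ (Fin q) →ₗ[ℝ] EuclideanSpace ℝ (Fin q))) = μq)
    {μr : Measure (EuclideanSpace ℝ (Fin r))} [IsProbabilityMeasure μr]
    (hμr : μr (Metric.sphere (0 : EuclideanSpace ℝ (Fin r)) 1) = 1)
    (hrinv : ∀ A ∈ Matrix.orthogonalGroup (Fin r) ℝ,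
      μr.map (⇑(Matrix.toEuclideanLin A :
        EuclideanSpace ℝ (Fin r) →ₗ[ℝ] EuclideanSpace ℝ (Fin r))) = μr)
    (T : Fin p → Fin q → Fin r → ℝ) :
    ∫ w : EuclideanSpace ℝ (Fin p) × EuclideanSpace ℝ (Fin q) × EuclideanSpace ℝ (Fin r),
        (∑ i, ∑ j, ∑ k, T i j k * w.1 i * w.2.1 j * w.2.2 k) ^ 4 ∂(μp.prod (μq.prod μr)) =
      (3 * frobSq T ^ 2 + 6 * P₁ T + 6 * P₂ T + 6 * P₃ T + 6 * P₄ T) /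
        ((p : ℝ) * (p + 2) * q * (q + 2) * r * (r + 2)) := by
  let s (n : ℕ) := Metric.sphere (0 : EuclideanSpace ℝ (Fin n)) 1
  have hs (n : ℕ) : IsCompact (s n) := isCompact_sphere 0 1
  have hqr : ∀ᵐ v ∂(μq.prod μr), v ∈ s q ×ˢ s r := by
    filter_upwards [Measure.quasiMeasurePreserving_fst.ae (ae_mem_sphere hμq),
      Measure.quasiMeasurePreserving_snd.ae (ae_mem_sphere hμr)] with v h₁ h₂ using ⟨h₁, h₂⟩
  have hpqr : ∀ᵐ w ∂(μp.prod (μq.prod μr)), w ∈ s p ×ˢ s q ×ˢ s r := by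
    filter_upwards [Measure.quasiMeasurePreserving_fst.ae (ae_mem_sphere hμp),
      Measure.quasiMeasurePreserving_snd.ae hqr] with w h₁ h₂ using ⟨h₁, h₂⟩
  let V (z : EuclideanSpace ℝ (Fin r)) (i : Fin p) (j : Fin q) : ℝ := ∑ k, T i j k * z k
  have integral_x (v : EuclideanSpace ℝ (Fin q) × EuclideanSpace ℝ (Fin r)) :
      ∫ x, (∑ i, ∑ j, ∑ k, T i j k * x i * v.1 j * v.2 k) ^ 4 ∂μp =
        3 / (p * (p + 2)) * ∑ a, ∑ b, (∑ j, V v.2 a j * v.1 j) * (∑ j, V v.2 a j * v.1 j) *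
          (∑ j, V v.2 b j * v.1 j) * (∑ j, V v.2 b j * v.1 j) := by
    have h (x : EuclideanSpace ℝ (Fin p)) :
        ∑ i, ∑ j, ∑ k, T i j k * x i * v.1 j * v.2 k =
          ∑ i, (∑ j, V v.2 i j * v.1 j) * x i := by
      simp only [V, Finset.sum_mul]
      exact Finset.sum_congr rfl fun i _ => Finset.sum_congr rfl fun j _ =>
        Finset.sum_congr rfl fun k _ => by ring
    have h4 (c : ℝ) : c ^ 4 = c * c * c * c := by ring
    simp only [h, h4]
    rw [integral_sum_mul_four hp hμp hpinv]
    have h2 : ∑ a, ∑ b, (∑ j, V v.2 a j * v.1 j) * (∑ j, V v.2 a j * v.1 j) *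
        (∑ j, V v.2 b j * v.1 j) * (∑ j, V v.2 b j * v.1 j) =
        (∑ a, (∑ j, V v.2 a j * v.1 j) * (∑ j, V v.2 a j * v.1 j)) *
          ∑ b, (∑ j, V v.2 b j * v.1 j) * (∑ j, V v.2 b j * v.1 j) := by
      simp only [Finset.sum_mul_sum Finset.univ Finset.univ
        (fun a => (∑ j, V v.2 a j * v.1 j) * (∑ j, V v.2 a j * v.1 j)), mul_assoc]
    rw [h2]
    ring
  have integral_y (z : EuclideanSpace ℝ (Fin r)) :
      ∫ y : EuclideanSpace ℝ (Fin q), 3 / ((p : ℝ) * (p + 2)) * ∑ a, ∑ b,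
          (∑ j, V z a j * y j) * (∑ j, V z a j * y j) *
          (∑ j, V z b j * y j) * (∑ j, V z b j * y j) ∂μq =
        3 / (p * (p + 2) * (q * (q + 2))) * ∑ a, ∑ b, ∑ c, ∑ d,
          (V z a c * V z a c * V z b d * V z b d + 2 * (V z a c * V z b c * V z a d * V z b d)) := by
    rw [integral_const_mul,
      integral_finsetSum _ fun a _ => integrable_of_sphere hμq (by fun_prop),
      show (3 : ℝ) / (p * (p + 2) * (q * (q + 2))) = 3 / (p * (p + 2)) * (1 / (q * (q + 2))) by
        rw [div_mul_div_comm, mul_one], mul_assoc, Finset.mul_sum _ _ (1 / ((q : ℝ) * (q + 2)))]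
    congr 1
    refine Finset.sum_congr rfl fun a _ => ?_
    rw [integral_finsetSum _ fun b _ => integrable_of_sphere hμq (by fun_prop), Finset.mul_sum]
    refine Finset.sum_congr rfl fun b _ => ?_
    rw [integral_sum_mul_four hq hμq hqinv]
    simp only [Finset.sum_add_distrib, ← Finset.mul_sum, mul_assoc]
    simp only [← mul_assoc (V z a _) (V z a _), ← mul_assoc (V z a _) (V z b _)]
    simp only [← Finset.sum_mul]
    ring
  have integral_z (a b : Fin p) (c d : Fin q) :
      ∫ z, (V z a c * V z a c * V z b d * V z b d +
        2 * (V z a c * V z b c * V z a d * V z b d)) ∂μr =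
      1 / (r * (r + 2)) * ∑ e, ∑ f, (T a c e ^ 2 * T b d f ^ 2 +
        2 * (T a c e * T a c f * T b d e * T b d f) + 2 * (T a c e * T a d f * T b c e * T b d f) +
        2 * (T a c e * T a d e * T b c f * T b d f) +
        2 * (T a c e * T a d f * T b d e * T b c f)) := by
    rw [integral_add (integrable_of_sphere hμr (by fun_prop))
      (integrable_of_sphere hμr (by fun_prop)), integral_const_mul,
      integral_sum_mul_four hr hμr hrinv, integral_sum_mul_four hr hμr hrinv]
    rw [mul_div_assoc', ← add_div, one_div_mul_eq_div]
    congr 1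
    simp only [Finset.sum_mul_sum]
    simp only [Finset.mul_sum, ← Finset.sum_add_distrib]
    exact Finset.sum_congr rfl fun e _ => Finset.sum_congr rfl fun f _ => by ring
  rw [integral_prod_symm _ (integrable_of_continuous_of_compact ((hs p).prod ((hs q).prod (hs r)))
    hpqr (by fun_prop))]
  simp only [integral_x]
  rw [integral_prod_symm _ (integrable_of_continuous_of_compact ((hs q).prod (hs r))
    hqr (by fun_prop))]
  simp only [integral_y]
  rw [integral_const_mul]
  simp (disch := fun_prop) only [integral_sum_of_sphere hμr, integral_z]
  have hfrob : frobSq T ^ 2 =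
      ∑ a, ∑ b, ∑ c, ∑ d, ∑ e, ∑ f, T a c e ^ 2 * T b d f ^ 2 := by
    simp only [frobSq, pow_two (∑ i, _), Finset.sum_mul_sum]
  simp only [← Finset.mul_sum, Finset.sum_add_distrib] at hfrob ⊢
  rw [← hfrob, ← P₁, ← P₂, ← P₃, ← P₄, ← mul_assoc, div_mul_div_comm,
    div_mul_eq_mul_div]
  congr 1 <;> ring

theorem rankOne_invariants {p q r : ℕ} {x : EuclideanSpace ℝ (Fin p)}
    {y : EuclideanSpace ℝ (Fin q)} {z : EuclideanSpace ℝ (Fin r)}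
    (hx : ‖x‖ = 1) (hy : ‖y‖ = 1) (hz : ‖z‖ = 1) :
    3 * frobSq (fun i j k => x i * y j * z k) ^ 2 + 6 * P₁ (fun i j k => x i * y j * z k) +
      6 * P₂ (fun i j k => x i * y j * z k) + 6 * P₃ (fun i j k => x i * y j * z k) +
      6 * P₄ (fun i j k => x i * y j * z k) = 27 := by
  have hsq {n : ℕ} {v : EuclideanSpace ℝ (Fin n)} (hv : ‖v‖ = 1) : ∑ i, v i ^ 2 = 1 := by
    rw [← EuclideanSpace.real_norm_sq_eq, hv, one_pow]
  have hfrob : frobSq (fun i j k => x i * y j * z k) = 1 := by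
    simp only [frobSq, mul_pow, ← Finset.mul_sum, hsq hx, hsq hy, hsq hz, mul_one]
  have hsix : ∑ a, ∑ b, ∑ c, ∑ d, ∑ e, ∑ f,
      x a ^ 2 * (x b ^ 2 * (y c ^ 2 * (y d ^ 2 * (z e ^ 2 * z f ^ 2)))) = 1 := by
    simp only [← Finset.mul_sum, hsq hx, hsq hy, hsq hz, mul_one]
  have h₁ : P₁ (fun i j k => x i * y j * z k) = 1 := by
    rw [← hsix, P₁]; congr! 6; ring
  have h₂ : P₂ (fun i j k => x i * y j * z k) = 1 := by
    rw [← hsix, P₂]; congr! 6; ring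
  have h₃ : P₃ (fun i j k => x i * y j * z k) = 1 := by
    rw [← hsix, P₃]; congr! 6; ring
  have h₄ : P₄ (fun i j k => x i * y j * z k) = 1 := by
    rw [← hsix, P₄]; congr! 6; ring
  rw [hfrob, h₁, h₂, h₃, h₄]
  norm_num

theorem stmt_10 (p q r : ℕ) (hp : 1 ≤ p) (hq : 1 ≤ q) (hr : 1 ≤ r)
    (μp : Measure (EuclideanSpace ℝ (Fin p))) [IsProbabilityMeasure μp]
    (hμp : μp (Metric.sphere (0 : EuclideanSpace ℝ (Fin p)) 1) = 1)
    (hpinv : ∀ A ∈ Matrix.orthogonalGroup (Fin p) ℝ,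
      μp.map (⇑(Matrix.toEuclideanLin A :
        EuclideanSpace ℝ (Fin p) →ₗ[ℝ] EuclideanSpace ℝ (Fin p))) = μp)
    (μq : Measure (EuclideanSpace ℝ (Fin q))) [IsProbabilityMeasure μq]
    (hμq : μq (Metric.sphere (0 : EuclideanSpace ℝ (Fin q)) 1) = 1)
    (hqinv : ∀ A ∈ Matrix.orthogonalGroup (Fin q) ℝ,
      μq.map (⇑(Matrix.toEuclideanLin A :
        EuclideanSpace ℝ (Fin q) →ₗ[ℝ] EuclideanSpace ℝ (Fin q))) = μq)
    (μr : Measure (EuclideanSpace ℝ (Fin r))) [IsProbabilityMeasure μr]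
    (hμr : μr (Metric.sphere (0 : EuclideanSpace ℝ (Fin r)) 1) = 1)
    (hrinv : ∀ A ∈ Matrix.orthogonalGroup (Fin r) ℝ,
      μr.map (⇑(Matrix.toEuclideanLin A :
        EuclideanSpace ℝ (Fin r) →ₗ[ℝ] EuclideanSpace ℝ (Fin r))) = μr)
    (T : Fin p → Fin q → Fin r → ℝ) :
    (∫ w : EuclideanSpace ℝ (Fin p) × EuclideanSpace ℝ (Fin q) × EuclideanSpace ℝ (Fin r),
        (∑ i, ∑ j, ∑ k, T i j k * w.1 i * w.2.1 j * w.2.2 k) ^ 4 ∂(μp.prod (μq.prod μr)) =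
      (3 * frobSq T ^ 2 + 6 * P₁ T + 6 * P₂ T + 6 * P₃ T + 6 * P₄ T) /
        ((p : ℝ) * (p + 2) * q * (q + 2) * r * (r + 2))) ∧
    ∀ (x₀ : EuclideanSpace ℝ (Fin p)) (y₀ : EuclideanSpace ℝ (Fin q))
        (z₀ : EuclideanSpace ℝ (Fin r)), ‖x₀‖ = 1 → ‖y₀‖ = 1 → ‖z₀‖ = 1 →
      (∫ w : EuclideanSpace ℝ (Fin p) × EuclideanSpace ℝ (Fin q) × EuclideanSpace ℝ (Fin r),
          (∑ i, ∑ j, ∑ k, T i j k * w.1 i * w.2.1 j * w.2.2 k) ^ 4 ∂(μp.prod (μq.prod μr))) /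
        (∫ w : EuclideanSpace ℝ (Fin p) × EuclideanSpace ℝ (Fin q) × EuclideanSpace ℝ (Fin r),
          (∑ i, ∑ j, ∑ k, (x₀ i * y₀ j * z₀ k) * w.1 i * w.2.1 j * w.2.2 k) ^ 4
            ∂(μp.prod (μq.prod μr))) =
      (3 * frobSq T ^ 2 + 6 * P₁ T + 6 * P₂ T + 6 * P₃ T + 6 * P₄ T) / 27 := by
  have hI (T : Fin p → Fin q → Fin r → ℝ) :=
    integral_multilinear_pow_four hp hq hr hμp hpinv hμq hqinv hμr hrinv T
  refine ⟨hI T, fun x₀ y₀ z₀ hx hy hz => ?_⟩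
  have hp' : (0 : ℝ) < p := by exact_mod_cast hp
  have hq' : (0 : ℝ) < q := by exact_mod_cast hq
  have hr' : (0 : ℝ) < r := by exact_mod_cast hr
  rw [hI T, hI fun i j k => x₀ i * y₀ j * z₀ k, rankOne_invariants hx hy hz]
  field_simp
end

section
/- Let m and d be positive integers and let f : (Fin m → ℝ) → ℝ be the evaluation of a homogeneous multivariate polynomial of degree d with real coefficients. Suppose f(x) > 0 for all x ≠ 0 and f is convex (equivalently, for such smooth f, its Hessian is positive semidefinite everywhere). Then d is even and the function N(x) := f(x)^{1/d} is a norm on ℝ^m: N(x) = 0 if and only if x = 0, N(λx) = |λ| N(x) for all λ ∈ ℝ, and N(x+y) ≤ N(x) + N(y) for all x, y. -/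
theorem MvPolynomial.IsHomogeneous.eval_smul_arg {σ R : Type*} [CommSemiring R]
    {P : MvPolynomial σ R} {d : ℕ} (hP : P.IsHomogeneous d) (l : R) (x : σ → R) :
    MvPolynomial.eval (l • x) P = l ^ d * MvPolynomial.eval x P := by
  rw [MvPolynomial.eval_eq, MvPolynomial.eval_eq, Finset.mul_sum]
  refine Finset.sum_congr rfl fun s hs => ?_
  have hs' : ∑ i ∈ s.support, s i = d := by
    rw [← hP (MvPolynomial.mem_support_iff.mp hs), Finsupp.weight_apply, Finsupp.sum]
    simp
  simp only [Pi.smul_apply, smul_eq_mul, mul_pow, Finset.prod_mul_distrib,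
    Finset.prod_pow_eq_pow_sum, hs']
  ring

/-- If `x` and `y` lie on the boundary of the `a`- and `b`-dilates of the unit sublevel set of a
convex function homogeneous of degree `d`, then `x + y` lies in the `(a + b)`-dilate. -/
theorem ConvexOn.map_add_le_add_pow {E : Type*} [AddCommGroup E] [Module ℝ E] {f : E → ℝ} {d : ℕ}
    (hconv : ConvexOn ℝ Set.univ f) (hsmul : ∀ (l : ℝ) (x : E), f (l • x) = l ^ d * f x)
    {a b : ℝ} (ha : 0 < a) (hb : 0 < b) {x y : E} (hx : f x = a ^ d) (hy : f y = b ^ d) :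
    f (x + y) ≤ (a + b) ^ d := by
  have hab : 0 < a + b := add_pos ha hb
  have hx1 : f (a⁻¹ • x) = 1 := by
    rw [hsmul, hx, ← mul_pow, inv_mul_cancel₀ ha.ne', one_pow]
  have hy1 : f (b⁻¹ • y) = 1 := by
    rw [hsmul, hy, ← mul_pow, inv_mul_cancel₀ hb.ne', one_pow]
  have hle := hconv.2 (Set.mem_univ (a⁻¹ • x)) (Set.mem_univ (b⁻¹ • y))
    (div_nonneg ha.le hab.le) (div_nonneg hb.le hab.le) (by field_simp)
  rw [hx1, hy1, smul_eq_mul, smul_eq_mul, mul_one, mul_one, ← add_div, div_self hab.ne'] at hle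
  have hxy : x + y = (a + b) • ((a / (a + b)) • a⁻¹ • x + (b / (a + b)) • b⁻¹ • y) := by
    rw [smul_add, smul_smul, smul_smul, smul_smul, smul_smul]
    have h₁ : (a + b) * (a / (a + b)) * a⁻¹ = 1 := by field_simp
    have h₂ : (a + b) * (b / (a + b)) * b⁻¹ = 1 := by field_simp
    simp only [h₁, h₂, one_smul]
  rw [hxy, hsmul]
  exact mul_le_of_le_one_right (pow_nonneg hab.le d) hle

theorem stmt_11 (m d : ℕ) (hm : 0 < m) (hd : 0 < d)
    (P : MvPolynomial (Fin m) ℝ) (hP : P.IsHomogeneous d)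
    (f : (Fin m → ℝ) → ℝ) (hf : ∀ x, f x = MvPolynomial.eval x P)
    (hpos : ∀ x : Fin m → ℝ, x ≠ 0 → 0 < f x)
    (hconv : ConvexOn ℝ Set.univ f) :
    Even d ∧
    (∀ x : Fin m → ℝ, f x ^ ((d : ℝ)⁻¹) = 0 ↔ x = 0) ∧
    (∀ (l : ℝ) (x : Fin m → ℝ), f (l • x) ^ ((d : ℝ)⁻¹) = |l| * f x ^ ((d : ℝ)⁻¹)) ∧
    (∀ x y : Fin m → ℝ, f (x + y) ^ ((d : ℝ)⁻¹) ≤ f x ^ ((d : ℝ)⁻¹) + f y ^ ((d : ℝ)⁻¹)) := by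
  have hsmul : ∀ (l : ℝ) (x : Fin m → ℝ), f (l • x) = l ^ d * f x := fun l x => by
    rw [hf, hf, hP.eval_smul_arg]
  have hzero : f 0 = 0 := by simpa [hd.ne'] using hsmul 0 0
  have hnonneg : ∀ x, 0 ≤ f x := fun x => by
    rcases eq_or_ne x 0 with rfl | hx
    exacts [hzero.ge, (hpos x hx).le]
  have hinv : (d : ℝ)⁻¹ ≠ 0 := inv_ne_zero (Nat.cast_ne_zero.mpr hd.ne')
  have heven : Even d := by
    by_contra hodd
    have hne : (fun _ : Fin m => (1 : ℝ)) ≠ 0 := fun h => one_ne_zero (congrFun h ⟨0, hm⟩)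
    have h := hsmul (-1) fun _ => 1
    rw [(Nat.not_even_iff_odd.mp hodd).neg_one_pow] at h
    linarith [hpos _ hne, hnonneg ((-1 : ℝ) • fun _ => 1)]
  refine ⟨heven, fun x => ?_, fun l x => ?_, fun x y => ?_⟩
  · rw [Real.rpow_eq_zero (hnonneg x) hinv]
    refine ⟨fun h => ?_, fun h => h ▸ hzero⟩
    by_contra hx
    exact (hpos x hx).ne' h
  · rw [hsmul, ← heven.pow_abs, Real.mul_rpow (by positivity) (hnonneg x),
      Real.pow_rpow_inv_natCast (abs_nonneg l) hd.ne']
  · rcases eq_or_ne x 0 with rfl | hx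
    · simp [hzero, Real.zero_rpow hinv]
    rcases eq_or_ne y 0 with rfl | hy
    · simp [hzero, Real.zero_rpow hinv]
    have ha := Real.rpow_pos_of_pos (hpos x hx) (d : ℝ)⁻¹
    have hb := Real.rpow_pos_of_pos (hpos y hy) (d : ℝ)⁻¹
    have h := hconv.map_add_le_add_pow hsmul ha hb
      (Real.rpow_inv_natCast_pow (hnonneg x) hd.ne').symm
      (Real.rpow_inv_natCast_pow (hnonneg y) hd.ne').symm
    calc f (x + y) ^ (d : ℝ)⁻¹
        ≤ ((f x ^ (d : ℝ)⁻¹ + f y ^ (d : ℝ)⁻¹) ^ d) ^ (d : ℝ)⁻¹ :=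
          Real.rpow_le_rpow (hnonneg _) h (by positivity)
      _ = f x ^ (d : ℝ)⁻¹ + f y ^ (d : ℝ)⁻¹ :=
          Real.pow_rpow_inv_natCast (add_pos ha hb).le hd.ne'
end

section
/- Let p, q, r ≥ 1. For every 3-way tensor T : Fin p → Fin q → Fin r → ℝ, the inequality P₁(T) + P₂(T) + P₃(T) + 2P₄(T) ≥ 0 holds. -/
open Finset in
/-- Cauchy–Schwarz for a square array against its transpose. -/
lemma sum_sq_add_sum_mul_transpose_nonneg {ι : Type*} [Fintype ι] (X : ι → ι → ℝ) :
    0 ≤ (∑ i, ∑ j, X i j ^ 2) + ∑ i, ∑ j, X i j * X j i := by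
  have h : ∑ i, ∑ j, (X i j + X j i) ^ 2 =
      2 * ((∑ i, ∑ j, X i j ^ 2) + ∑ i, ∑ j, X i j * X j i) := by
    have hcomm : ∑ i, ∑ j, X j i ^ 2 = ∑ i, ∑ j, X i j ^ 2 := sum_comm
    simp only [add_sq, sum_add_distrib, hcomm, mul_assoc, ← mul_sum]
    ring
  have : 0 ≤ ∑ i, ∑ j, (X i j + X j i) ^ 2 := by positivity
  linarith

lemma P₁_nonneg {p q r : ℕ} (T : Fin p → Fin q → Fin r → ℝ) : 0 ≤ P₁ T := by
  have h : P₁ T = ∑ a, ∑ b, (∑ c, ∑ e, T a c e * T b c e) ^ 2 := by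
    unfold P₁
    refine Finset.sum_congr rfl fun a _ => Finset.sum_congr rfl fun b _ => ?_
    rw [sq, Finset.sum_mul_sum]
    refine Finset.sum_congr rfl fun c _ => Finset.sum_congr rfl fun d _ => ?_
    rw [Finset.sum_mul_sum]
    refine Finset.sum_congr rfl fun e _ => Finset.sum_congr rfl fun f _ => ?_
    ring
  rw [h]
  positivity

lemma P₃_add_P₄_nonneg {p q r : ℕ} (T : Fin p → Fin q → Fin r → ℝ) : 0 ≤ P₃ T + P₄ T := by
  have h : P₃ T + P₄ T = ∑ a, ∑ b,
      ((∑ c, ∑ d, (∑ e, T a c e * T b d e) ^ 2) +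
        ∑ c, ∑ d, (∑ e, T a c e * T b d e) * ∑ e, T a d e * T b c e) := by
    simp only [P₃, P₄, sq, Finset.sum_mul_sum, ← Finset.sum_add_distrib]
    congr! 6
    ring
  rw [h]
  exact Finset.sum_nonneg fun a _ => Finset.sum_nonneg fun b _ =>
    sum_sq_add_sum_mul_transpose_nonneg fun c d => ∑ e, T a c e * T b d e

lemma sum_pair_comm {ι κ : Type*} [Fintype ι] [Fintype κ] (g : ι → ι → κ → κ → ℝ) :
    ∑ c, ∑ d, ∑ e, ∑ f, g c d e f = ∑ e, ∑ f, ∑ c, ∑ d, g c d e f := by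
  calc
    _ = ∑ e, ∑ c, ∑ d, ∑ f, g c d e f := by
      simp_rw [Finset.sum_comm (s := (Finset.univ : Finset κ)) (t := (Finset.univ : Finset ι))]
    _ = _ := Finset.sum_congr rfl fun e _ => by
      simp_rw [Finset.sum_comm (s := (Finset.univ : Finset κ)) (t := (Finset.univ : Finset ι))]

lemma P₂_add_P₄_nonneg {p q r : ℕ} (T : Fin p → Fin q → Fin r → ℝ) : 0 ≤ P₂ T + P₄ T := by
  have h₂ : P₂ T = P₃ fun a e c => T a c e := by
    simp only [P₂, P₃]
    refine Finset.sum_congr rfl fun a _ => Finset.sum_congr rfl fun b _ => ?_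
    exact sum_pair_comm _
  have h₄ : P₄ T = P₄ fun a e c => T a c e := by
    simp only [P₄]
    refine Finset.sum_congr rfl fun a _ => Finset.sum_congr rfl fun b _ => ?_
    rw [sum_pair_comm]
    refine Finset.sum_congr rfl fun e _ => Finset.sum_congr rfl fun f _ => ?_
    refine Finset.sum_congr rfl fun c _ => Finset.sum_congr rfl fun d _ => ?_
    ring
  rw [h₂, h₄]
  exact P₃_add_P₄_nonneg _

theorem stmt_13 (p q r : ℕ) (hp : 1 ≤ p) (hq : 1 ≤ q) (hr : 1 ≤ r)
    (T : Fin p → Fin q → Fin r → ℝ) :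
    0 ≤ P₁ T + P₂ T + P₃ T + 2 * P₄ T := by
  linarith [P₁_nonneg T, P₂_add_P₄_nonneg T, P₃_add_P₄_nonneg T]
end

section
/- Let p, q, r ≥ 1. For every 3-way tensor T : Fin p → Fin q → Fin r → ℝ, each of the three frame invariants plus the tetrahedron invariant is nonnegative: P₁(T) + P₄(T) ≥ 0, P₂(T) + P₄(T) ≥ 0, and P₃(T) + P₄(T) ≥ 0. -/
theorem sum_sum_comm_sum_sum {α β : Type*} [Fintype α] [Fintype β] (F : α → α → β → β → ℝ) :
    ∑ a, ∑ b, ∑ c, ∑ d, F a b c d = ∑ c, ∑ d, ∑ a, ∑ b, F a b c d := by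
  calc
    _ = ∑ a, ∑ c, ∑ d, ∑ b, F a b c d := Finset.sum_congr rfl fun a _ => by
      rw [Finset.sum_comm]
      exact Finset.sum_congr rfl fun c _ => Finset.sum_comm
    _ = _ := by
      rw [Finset.sum_comm]
      exact Finset.sum_congr rfl fun c _ => Finset.sum_comm

theorem sum_sq_add_mul_swap_nonneg {β γ : Type*} [Fintype β] [Fintype γ]
    (X : β → β → γ → γ → ℝ) :
    0 ≤ ∑ c, ∑ d, ∑ e, ∑ f, (X c d e f * X c d e f + X c d e f * X d c e f) := by
  have h : ∑ c, ∑ d, ∑ e, ∑ f, X c d e f ^ 2 = ∑ c, ∑ d, ∑ e, ∑ f, X d c e f ^ 2 :=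
    Finset.sum_comm
  have h₀ : 0 ≤ ∑ c, ∑ d, ∑ e, ∑ f, (X c d e f + X d c e f) ^ 2 := by positivity
  simp only [add_sq, mul_assoc, ← pow_two, Finset.sum_add_distrib, ← Finset.mul_sum] at h₀ ⊢
  linarith

theorem P₁_add_P₄_nonneg {p q r : ℕ} (T : Fin p → Fin q → Fin r → ℝ) : 0 ≤ P₁ T + P₄ T := by
  convert sum_sq_add_mul_swap_nonneg (fun c d e f => ∑ a, T a c e * T a d f) using 1
  simp only [P₁, P₄, ← Finset.sum_add_distrib, Finset.sum_mul_sum]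
  rw [sum_sum_comm_sum_sum]
  refine Finset.sum_congr rfl fun c _ => Finset.sum_congr rfl fun d _ => ?_
  rw [sum_sum_comm_sum_sum]
  simp only [mul_assoc]

theorem P₁_swap_left {p q r : ℕ} (T : Fin p → Fin q → Fin r → ℝ) :
    P₁ (fun c a e => T a c e) = P₂ T := by
  unfold P₁ P₂
  rw [sum_sum_comm_sum_sum]
  simp only [mul_comm, mul_left_comm]

theorem P₄_swap_left {p q r : ℕ} (T : Fin p → Fin q → Fin r → ℝ) :
    P₄ (fun c a e => T a c e) = P₄ T := by
  unfold P₄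
  rw [sum_sum_comm_sum_sum]
  simp only [mul_comm, mul_left_comm]

theorem sum_sum_sum_reverse {α β γ : Type*} [Fintype α] [Fintype β] [Fintype γ]
    (F : α → α → β → β → γ → γ → ℝ) :
    ∑ a, ∑ b, ∑ c, ∑ d, ∑ e, ∑ f, F a b c d e f =
      ∑ e, ∑ f, ∑ c, ∑ d, ∑ a, ∑ b, F a b c d e f := by
  rw [sum_sum_comm_sum_sum]
  simp_rw [sum_sum_comm_sum_sum (α := α)]
  exact sum_sum_comm_sum_sum _

theorem P₁_reverse {p q r : ℕ} (T : Fin p → Fin q → Fin r → ℝ) :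
    P₁ (fun e c a => T a c e) = P₃ T := by
  unfold P₁ P₃
  rw [sum_sum_sum_reverse]
  simp only [mul_comm, mul_left_comm]

theorem P₄_reverse {p q r : ℕ} (T : Fin p → Fin q → Fin r → ℝ) :
    P₄ (fun e c a => T a c e) = P₄ T := by
  unfold P₄
  rw [sum_sum_sum_reverse]
  simp only [mul_comm, mul_left_comm]

theorem stmt_14 (p q r : ℕ) (hp : 1 ≤ p) (hq : 1 ≤ q) (hr : 1 ≤ r)
    (T : Fin p → Fin q → Fin r → ℝ) :
    0 ≤ P₁ T + P₄ T ∧ 0 ≤ P₂ T + P₄ T ∧ 0 ≤ P₃ T + P₄ T := by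
  refine ⟨P₁_add_P₄_nonneg T, ?_, ?_⟩
  · rw [← P₁_swap_left, ← P₄_swap_left]
    exact P₁_add_P₄_nonneg _
  · rw [← P₁_reverse, ← P₄_reverse]
    exact P₁_add_P₄_nonneg _
end

section
/- Let p, q, r ≥ 1 and let μ be the uniform probability measure on the unit sphere (with respect to the Euclidean/Frobenius norm) of the pqr-dimensional space of 3-way tensors T : Fin p → Fin q → Fin r → ℝ. Then ∫ (3‖T‖⁴ + 6P₁(T) + 6P₂(T) + 6P₃(T) + 6P₄(T))/27 dμ(T) = (pqr + 2(pq+pr+qr) + 4(p+q+r) + 8) / (9(pqr+2)). In other words, the expected value of ‖T‖_{σ,4}⁴ for a uniformly random unit tensor T equals this quantity. -/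
open MeasureTheory

section SphericalMoments

variable {E : Type*} [NormedAddCommGroup E] [InnerProductSpace ℝ E] [FiniteDimensional ℝ E]
  [MeasurableSpace E] [BorelSpace E] {μ : Measure E}

theorem integrable_of_continuous_of_ae_norm_eq_one [IsFiniteMeasure μ] (hμ : ∀ᵐ w ∂μ, ‖w‖ = 1)
    {f : E → ℝ} (hf : Continuous f) : Integrable f μ := by
  obtain ⟨B, hB⟩ := (isCompact_sphere (0 : E) 1).exists_bound_of_continuousOn hf.continuousOn
  refine Integrable.of_bound hf.aestronglyMeasurable B ?_
  filter_upwards [hμ] with w hw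
  exact hB w (by simpa using hw)

theorem integral_inner_pow_four_eq_of_norm_eq_s15
    (hinv : ∀ e : E ≃ₗᵢ[ℝ] E, μ.map e = μ) {u v : E} (h : ‖u‖ = ‖v‖) :
    ∫ w, inner ℝ u w ^ 4 ∂μ = ∫ w, inner ℝ v w ^ 4 ∂μ := by
  set e : E ≃ₗᵢ[ℝ] E := (Submodule.span ℝ {u - v})ᗮ.reflection
  have he : e u = v := Submodule.reflection_sub h
  conv_rhs => rw [← hinv e]
  rw [integral_map e.continuous.aemeasurable (by fun_prop), ← he]
  simp only [e.inner_map_map]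

theorem exists_integral_inner_pow_four_eq (hinv : ∀ e : E ≃ₗᵢ[ℝ] E, μ.map e = μ) :
    ∃ C : ℝ, ∀ v : E, ∫ w, inner ℝ v w ^ 4 ∂μ = 3 * C * ‖v‖ ^ 4 := by
  rcases subsingleton_or_nontrivial E with _ | _
  · exact ⟨0, fun v => by simp [Subsingleton.elim v 0]⟩
  obtain ⟨v₀, hv₀⟩ := exists_norm_eq E zero_le_one
  refine ⟨(∫ w, inner ℝ v₀ w ^ 4 ∂μ) / 3, fun v => ?_⟩
  rw [integral_inner_pow_four_eq_of_norm_eq_s15 hinv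
    (show ‖v‖ = ‖‖v‖ • v₀‖ by simp [norm_smul, hv₀])]
  simp only [real_inner_smul_left, mul_pow, integral_const_mul]
  ring

/-- The fourth moment tensor of a rotation-invariant finite measure on the unit sphere. -/
theorem exists_integral_inner_mul_eq [IsFiniteMeasure μ] (hμ : ∀ᵐ w ∂μ, ‖w‖ = 1)
    (hinv : ∀ e : E ≃ₗᵢ[ℝ] E, μ.map e = μ) :
    ∃ C : ℝ, ∀ x y z u : E,
      ∫ w, inner ℝ x w * inner ℝ y w * inner ℝ z w * inner ℝ u w ∂μ =
        C * (inner ℝ x y * inner ℝ z u + inner ℝ x z * inner ℝ y u +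
          inner ℝ x u * inner ℝ y z) := by
  obtain ⟨C, hC⟩ := exists_integral_inner_pow_four_eq hinv
  refine ⟨C, fun x y z u => ?_⟩
  have hInt (v : E) : Integrable (fun w => inner ℝ v w ^ 4) μ :=
    integrable_of_continuous_of_ae_norm_eq_one hμ (by fun_prop)
  have polarization (w : E) :
      inner ℝ x w * inner ℝ y w * inner ℝ z w * inner ℝ u w =
        (inner ℝ (x + y + z + u) w ^ 4 - inner ℝ (x + y + z - u) w ^ 4
          - inner ℝ (x + y - z + u) w ^ 4 + inner ℝ (x + y - z - u) w ^ 4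
          - inner ℝ (x - y + z + u) w ^ 4 + inner ℝ (x - y + z - u) w ^ 4
          + inner ℝ (x - y - z + u) w ^ 4 - inner ℝ (x - y - z - u) w ^ 4) / 192 := by
    simp only [inner_add_left, inner_sub_left]
    ring
  simp only [polarization]
  have hnorm (v : E) : ‖v‖ ^ 4 = inner ℝ v v ^ 2 := by rw [real_inner_self_eq_norm_sq]; ring
  rw [integral_div, integral_sub (by fun_prop) (by fun_prop),
    integral_add (by fun_prop) (by fun_prop), integral_add (by fun_prop) (by fun_prop),
    integral_sub (by fun_prop) (by fun_prop), integral_add (by fun_prop) (by fun_prop), integral_sub (by fun_prop) (by fun_prop),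
    integral_sub (by fun_prop) (by fun_prop)]
  simp only [hC]
  simp only [hnorm, inner_add_left, inner_sub_left, inner_add_right, inner_sub_right,
    real_inner_comm x y, real_inner_comm x z, real_inner_comm x u, real_inner_comm y z,
    real_inner_comm y u, real_inner_comm z u]
  ring

end SphericalMoments

section Coordinates

variable {ι : Type*} [Fintype ι] [DecidableEq ι] {μ : Measure (EuclideanSpace ℝ ι)}

theorem map_linearIsometryEquiv_eq_of_orthogonalGroup
    (hinv : ∀ A ∈ Matrix.orthogonalGroup ι ℝ,
      μ.map (⇑(Matrix.toEuclideanLin A : EuclideanSpace ℝ ι →ₗ[ℝ] EuclideanSpace ℝ ι)) = μ)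
    (e : EuclideanSpace ℝ ι ≃ₗᵢ[ℝ] EuclideanSpace ℝ ι) : μ.map e = μ := by
  let b := EuclideanSpace.basisFun ι ℝ
  have h := hinv _ (e.toMatrix_mem_unitaryGroup b b)
  rw [Matrix.toEuclideanLin_eq_toLin_orthonormal, Matrix.toLin_toMatrix] at h
  exact h

theorem integral_coord_mul_eq [IsProbabilityMeasure μ] [Nonempty ι] (hμ : ∀ᵐ w ∂μ, ‖w‖ = 1)
    (hinv : ∀ e : EuclideanSpace ℝ ι ≃ₗᵢ[ℝ] EuclideanSpace ℝ ι, μ.map e = μ) (x y z u : ι) :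
    ∫ w, w x * w y * w z * w u ∂μ =
      ((if x = y ∧ z = u then 1 else 0) + (if x = z ∧ y = u then 1 else 0) +
        (if x = u ∧ y = z then 1 else 0)) / (Fintype.card ι * (Fintype.card ι + 2)) := by
  obtain ⟨C, hC⟩ := exists_integral_inner_mul_eq hμ hinv
  replace hC (x y z u : ι) : ∫ w, w x * w y * w z * w u ∂μ =
      C * ((if x = y ∧ z = u then 1 else 0) + (if x = z ∧ y = u then 1 else 0) +
        (if x = u ∧ y = z then 1 else 0)) := by
    have := hC (EuclideanSpace.single x 1) (EuclideanSpace.single y 1)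
      (EuclideanSpace.single z 1) (EuclideanSpace.single u 1)
    simpa [EuclideanSpace.inner_single_left, PiLp.single_apply, ← ite_and, and_comm,
      eq_comm] using this
  have hone : C * (Fintype.card ι * (Fintype.card ι + 2)) = 1 := by
    calc C * (Fintype.card ι * (Fintype.card ι + 2))
        = ∑ i : ι, ∑ j : ι, ∫ w, w i * w i * w j * w j ∂μ := by
          simp only [hC, ← Finset.mul_sum, Finset.sum_add_distrib]
          congr 1
          simp
          ring
      _ = ∫ w, (∑ i, w i ^ 2) ^ 2 ∂μ := by
          have hInt (i j : ι) : Integrable (fun w => w i * w i * w j * w j) μ :=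
            integrable_of_continuous_of_ae_norm_eq_one hμ (by fun_prop)
          simp_rw [← integral_finsetSum _ fun j _ => hInt _ j]
          rw [← integral_finsetSum _ fun i _ => integrable_finsetSum _ fun j _ => hInt i j]
          congr! 2 with w
          rw [sq, Finset.sum_mul_sum]
          congr! 2
          ring
      _ = ∫ _, 1 ∂μ := by
          refine integral_congr_ae ?_
          filter_upwards [hμ] with w hw
          rw [← EuclideanSpace.real_norm_sq_eq, hw]
          norm_num
      _ = 1 := by simp
  rw [hC, ← mul_one_div, eq_div_of_mul_eq (by positivity) hone]
  ring

theorem integral_sum_coord_mul_eq [IsProbabilityMeasure μ] [Nonempty ι] {κ : Type*} [Fintype κ]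
    (hμ : ∀ᵐ w ∂μ, ‖w‖ = 1)
    (hinv : ∀ e : EuclideanSpace ℝ ι ≃ₗᵢ[ℝ] EuclideanSpace ℝ ι, μ.map e = μ) (x y z u : κ → ι) :
    ∫ w, ∑ k, w (x k) * w (y k) * w (z k) * w (u k) ∂μ =
      (∑ k, ((if x k = y k ∧ z k = u k then 1 else 0) + (if x k = z k ∧ y k = u k then 1 else 0) +
        (if x k = u k ∧ y k = z k then 1 else 0))) /
          (Fintype.card ι * (Fintype.card ι + 2)) := by
  rw [integral_finsetSum _ fun k _ =>
    integrable_of_continuous_of_ae_norm_eq_one hμ (by fun_prop), Finset.sum_div]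
  simp only [integral_coord_mul_eq hμ hinv]

end Coordinates

section Invariants

variable {p q r : ℕ} [NeZero p] [NeZero q] [NeZero r]
  {μ : Measure (EuclideanSpace ℝ (Fin p × Fin q × Fin r))} [IsProbabilityMeasure μ]

theorem integral_P₁ (hμ : ∀ᵐ w ∂μ, ‖w‖ = 1)
    (hinv : ∀ e : EuclideanSpace ℝ (Fin p × Fin q × Fin r) ≃ₗᵢ[ℝ]
      EuclideanSpace ℝ (Fin p × Fin q × Fin r), μ.map e = μ) :
    ∫ w, P₁ (fun i j k => w (i, j, k)) ∂μ = ((p : ℝ) + q * r + 1) / (p * q * r + 2) := by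
  have h := integral_sum_coord_mul_eq
    (κ := Fin p × Fin p × Fin q × Fin q × Fin r × Fin r) hμ hinv
    (fun ⟨a, _, c, _, e, _⟩ => (a, c, e)) (fun ⟨a, _, _, d, _, f⟩ => (a, d, f))
    (fun ⟨_, b, c, _, e, _⟩ => (b, c, e)) (fun ⟨_, b, _, d, _, f⟩ => (b, d, f))
  simp only [Fintype.sum_prod_type] at h
  have hp : (p : ℝ) ≠ 0 := NeZero.ne _
  have hq : (q : ℝ) ≠ 0 := NeZero.ne _
  have hr : (r : ℝ) ≠ 0 := NeZero.ne _
  simp only [P₁, h, Finset.sum_add_distrib]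
  simp [ite_and]
  field_simp

theorem integral_P₂ (hμ : ∀ᵐ w ∂μ, ‖w‖ = 1)
    (hinv : ∀ e : EuclideanSpace ℝ (Fin p × Fin q × Fin r) ≃ₗᵢ[ℝ]
      EuclideanSpace ℝ (Fin p × Fin q × Fin r), μ.map e = μ) :
    ∫ w, P₂ (fun i j k => w (i, j, k)) ∂μ = ((p : ℝ) * r + q + 1) / (p * q * r + 2) := by
  have h := integral_sum_coord_mul_eq
    (κ := Fin p × Fin p × Fin q × Fin q × Fin r × Fin r) hμ hinv
    (fun ⟨a, _, c, _, e, _⟩ => (a, c, e)) (fun ⟨a, _, _, d, e, _⟩ => (a, d, e))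
    (fun ⟨_, b, c, _, _, f⟩ => (b, c, f)) (fun ⟨_, b, _, d, _, f⟩ => (b, d, f))
  simp only [Fintype.sum_prod_type] at h
  have hp : (p : ℝ) ≠ 0 := NeZero.ne _
  have hq : (q : ℝ) ≠ 0 := NeZero.ne _
  have hr : (r : ℝ) ≠ 0 := NeZero.ne _
  simp only [P₂, h, Finset.sum_add_distrib]
  simp [ite_and]
  field_simp

theorem integral_P₃ (hμ : ∀ᵐ w ∂μ, ‖w‖ = 1)
    (hinv : ∀ e : EuclideanSpace ℝ (Fin p × Fin q × Fin r) ≃ₗᵢ[ℝ]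
      EuclideanSpace ℝ (Fin p × Fin q × Fin r), μ.map e = μ) :
    ∫ w, P₃ (fun i j k => w (i, j, k)) ∂μ = ((p : ℝ) * q + r + 1) / (p * q * r + 2) := by
  have h := integral_sum_coord_mul_eq
    (κ := Fin p × Fin p × Fin q × Fin q × Fin r × Fin r) hμ hinv
    (fun ⟨a, _, c, _, e, _⟩ => (a, c, e)) (fun ⟨a, _, c, _, _, f⟩ => (a, c, f))
    (fun ⟨_, b, _, d, e, _⟩ => (b, d, e)) (fun ⟨_, b, _, d, _, f⟩ => (b, d, f))
  simp only [Fintype.sum_prod_type] at h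
  have hp : (p : ℝ) ≠ 0 := NeZero.ne _
  have hq : (q : ℝ) ≠ 0 := NeZero.ne _
  have hr : (r : ℝ) ≠ 0 := NeZero.ne _
  simp only [P₃, h, Finset.sum_add_distrib]
  simp [ite_and]
  field_simp

theorem integral_P₄ (hμ : ∀ᵐ w ∂μ, ‖w‖ = 1)
    (hinv : ∀ e : EuclideanSpace ℝ (Fin p × Fin q × Fin r) ≃ₗᵢ[ℝ]
      EuclideanSpace ℝ (Fin p × Fin q × Fin r), μ.map e = μ) :
    ∫ w, P₄ (fun i j k => w (i, j, k)) ∂μ = ((p : ℝ) + q + r) / (p * q * r + 2) := by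
  have h := integral_sum_coord_mul_eq
    (κ := Fin p × Fin p × Fin q × Fin q × Fin r × Fin r) hμ hinv
    (fun ⟨a, _, c, _, e, _⟩ => (a, c, e)) (fun ⟨a, _, _, d, _, f⟩ => (a, d, f))
    (fun ⟨_, b, _, d, e, _⟩ => (b, d, e)) (fun ⟨_, b, c, _, _, f⟩ => (b, c, f))
  simp only [Fintype.sum_prod_type] at h
  have hp : (p : ℝ) ≠ 0 := NeZero.ne _
  have hq : (q : ℝ) ≠ 0 := NeZero.ne _
  have hr : (r : ℝ) ≠ 0 := NeZero.ne _
  simp only [P₄, h, Finset.sum_add_distrib]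
  simp [ite_and]
  field_simp
  ring

end Invariants

theorem stmt_15 (p q r : ℕ) (hp : 1 ≤ p) (hq : 1 ≤ q) (hr : 1 ≤ r)
    (μ : Measure (EuclideanSpace ℝ (Fin p × Fin q × Fin r))) [IsProbabilityMeasure μ]
    (hsphere : μ (Metric.sphere (0 : EuclideanSpace ℝ (Fin p × Fin q × Fin r)) 1) = 1)
    (hinv : ∀ A ∈ Matrix.orthogonalGroup (Fin p × Fin q × Fin r) ℝ,
      μ.map (⇑(Matrix.toEuclideanLin A :
        EuclideanSpace ℝ (Fin p × Fin q × Fin r) →ₗ[ℝ]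
          EuclideanSpace ℝ (Fin p × Fin q × Fin r))) = μ) :
    ∫ w : EuclideanSpace ℝ (Fin p × Fin q × Fin r),
        (3 * frobSq (fun i j k => w (i, j, k)) ^ 2 + 6 * P₁ (fun i j k => w (i, j, k)) +
          6 * P₂ (fun i j k => w (i, j, k)) + 6 * P₃ (fun i j k => w (i, j, k)) +
          6 * P₄ (fun i j k => w (i, j, k))) / 27 ∂μ =
      ((p : ℝ) * q * r + 2 * ((p : ℝ) * q + p * r + q * r) + 4 * ((p : ℝ) + q + r) + 8) /
        (9 * ((p : ℝ) * q * r + 2)) := by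
  have : NeZero p := ⟨by omega⟩
  have : NeZero q := ⟨by omega⟩
  have : NeZero r := ⟨by omega⟩
  have hμ : ∀ᵐ w ∂μ, ‖w‖ = 1 := by
    filter_upwards [(mem_ae_iff_prob_eq_one Metric.isClosed_sphere.measurableSet).2 hsphere]
      with w hw
    simpa using hw
  have hiso := map_linearIsometryEquiv_eq_of_orthogonalGroup hinv
  have hfrob : ∀ᵐ w ∂μ, frobSq (fun i j k => w (i, j, k)) = 1 := by
    filter_upwards [hμ] with w hw
    have h := EuclideanSpace.real_norm_sq_eq w
    simp only [hw, Fintype.sum_prod_type] at h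
    simpa [frobSq] using h.symm
  have hInt {f : EuclideanSpace ℝ (Fin p × Fin q × Fin r) → ℝ} (hf : Continuous f) :
      Integrable f μ := integrable_of_continuous_of_ae_norm_eq_one hμ hf
  have h₁ : Integrable (fun w => P₁ (fun i j k => w (i, j, k))) μ :=
    hInt (by unfold P₁; fun_prop)
  have h₂ : Integrable (fun w => P₂ (fun i j k => w (i, j, k))) μ :=
    hInt (by unfold P₂; fun_prop)
  have h₃ : Integrable (fun w => P₃ (fun i j k => w (i, j, k))) μ :=
    hInt (by unfold P₃; fun_prop)
  have h₄ : Integrable (fun w => P₄ (fun i j k => w (i, j, k))) μ :=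
    hInt (by unfold P₄; fun_prop)
  calc _ = ∫ w, (3 + 6 * P₁ (fun i j k => w (i, j, k)) + 6 * P₂ (fun i j k => w (i, j, k)) +
          6 * P₃ (fun i j k => w (i, j, k)) + 6 * P₄ (fun i j k => w (i, j, k))) / 27 ∂μ := by
        refine integral_congr_ae ?_
        filter_upwards [hfrob] with w hw
        rw [hw]
        norm_num
    _ = _ := by
        rw [integral_div, integral_add (by fun_prop) (by fun_prop),
          integral_add (by fun_prop) (by fun_prop), integral_add (by fun_prop) (by fun_prop),
          integral_add (by fun_prop) (by fun_prop)]
        simp only [integral_const_mul, integral_P₁ hμ hiso, integral_P₂ hμ hiso,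
          integral_P₃ hμ hiso, integral_P₄ hμ hiso, integral_const, probReal_univ, smul_eq_mul]
        field_simp
        ring
end

section
/- Let p, q, r ≥ 1 and let μ be the uniform probability measure on the unit sphere (with respect to the Euclidean/Frobenius norm) of the pqr-dimensional space of 3-way tensors T : Fin p → Fin q → Fin r → ℝ. Then ∫ (P₁(T) + P₂(T) + P₃(T) + 2P₄(T))/5 dμ(T) = ((pq+pr+qr) + 3(p+q+r) + 3) / (5(pqr+2)). In other words, the expected value of ‖T‖_#⁴ for a uniformly random unit tensor T equals this quantity. -/
open MeasureTheory


theorem integrable_inner_mul_four {E : Type*} [NormedAddCommGroup E] [InnerProductSpace ℝ E]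
    [MeasurableSpace E] [BorelSpace E] [SecondCountableTopology E] {μ : Measure E}
    [IsFiniteMeasure μ] (hμ : ∀ᵐ w ∂μ, ‖w‖ = 1) (x y z t : E) :
    Integrable (fun w ↦ inner ℝ x w * inner ℝ y w * inner ℝ z w * inner ℝ t w) μ := by
  refine Integrable.of_bound (by fun_prop) (‖x‖ * ‖y‖ * ‖z‖ * ‖t‖) ?_
  filter_upwards [hμ] with w hw
  have h (v : E) : ‖inner ℝ v w‖ ≤ ‖v‖ := by simpa [hw] using norm_inner_le_norm (𝕜 := ℝ) v w
  simp only [norm_mul]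
  gcongr <;> apply h

theorem integral_inner_pow_four {E : Type*} [NormedAddCommGroup E] [InnerProductSpace ℝ E]
    [MeasurableSpace E] [BorelSpace E] [CompleteSpace E] {μ : Measure E}
    (hinv : ∀ R : E ≃ₗᵢ[ℝ] E, μ.map R = μ) {u : E} (hu : ‖u‖ = 1) (v : E) :
    ∫ w, inner ℝ v w ^ 4 ∂μ = ‖v‖ ^ 4 * ∫ w, inner ℝ u w ^ 4 ∂μ := by
  set s : E := ‖v‖ • u
  have hs : ‖v‖ = ‖s‖ := by simp [s, norm_smul, hu]
  set R := (Submodule.span ℝ {v - s})ᗮ.reflection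
  have hR : R v = s := Submodule.reflection_sub hs
  calc ∫ w, inner ℝ v w ^ 4 ∂μ = ∫ w, inner ℝ v w ^ 4 ∂(μ.map R.symm) := by rw [hinv]
    _ = ∫ w, inner ℝ v (R.symm w) ^ 4 ∂μ :=
        R.symm.toHomeomorph.measurableEmbedding.integral_map _
    _ = ∫ w, ‖v‖ ^ 4 * inner ℝ u w ^ 4 ∂μ := by
        refine integral_congr_ae (.of_forall fun w ↦ ?_)
        simp only
        rw [← R.inner_map_map v, R.apply_symm_apply, hR, real_inner_smul_left, mul_pow]
    _ = _ := integral_const_mul _ _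

/-- Isserlis-type formula for the fourth moments of a rotation invariant measure on the sphere. -/
theorem integral_inner_mul_four_s16 {E : Type*} [NormedAddCommGroup E] [InnerProductSpace ℝ E]
    [MeasurableSpace E] [BorelSpace E] [SecondCountableTopology E] [CompleteSpace E] {μ : Measure E}
    [IsFiniteMeasure μ] (hμ : ∀ᵐ w ∂μ, ‖w‖ = 1)
    (hinv : ∀ R : E ≃ₗᵢ[ℝ] E, μ.map R = μ) {u : E} (hu : ‖u‖ = 1) (x y z t : E) :
    ∫ w, inner ℝ x w * inner ℝ y w * inner ℝ z w * inner ℝ t w ∂μ =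
      (∫ w, inner ℝ u w ^ 4 ∂μ) / 3 * (inner ℝ x y * inner ℝ z t + inner ℝ x z * inner ℝ y t +
        inner ℝ x t * inner ℝ y z) := by
  have hi (v : E) : Integrable (fun w ↦ inner ℝ v w ^ 4) μ := by
    refine (integrable_inner_mul_four hμ v v v v).congr (.of_forall fun w ↦ ?_)
    simp only; ring
  have key (w : E) : inner ℝ x w * inner ℝ y w * inner ℝ z w * inner ℝ t w =
      (inner ℝ (x + y + z + t) w ^ 4 + inner ℝ (x + y - z - t) w ^ 4
      + inner ℝ (x - y + z - t) w ^ 4 + inner ℝ (x - y - z + t) w ^ 4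
      - inner ℝ (x + y + z - t) w ^ 4 - inner ℝ (x + y - z + t) w ^ 4
      - inner ℝ (x - y + z + t) w ^ 4 - inner ℝ (x - y - z - t) w ^ 4) / 192 := by
    simp only [inner_add_left, inner_sub_left]; ring
  have hn (v : E) : ‖v‖ ^ 4 = inner ℝ v v ^ 2 := by rw [real_inner_self_eq_norm_sq]; ring
  have hI := integral_inner_pow_four hinv hu
  generalize ∫ w, inner ℝ u w ^ 4 ∂μ = C at hI ⊢
  simp_rw [key]
  rw [integral_div, integral_sub, integral_sub, integral_sub, integral_sub, integral_add,
    integral_add, integral_add]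
  · simp only [hI, hn]
    simp only [inner_add_left, inner_sub_left, inner_add_right, inner_sub_right]
    rw [real_inner_comm x y, real_inner_comm x z, real_inner_comm x t, real_inner_comm y z,
      real_inner_comm y t, real_inner_comm z t]
    ring
  all_goals fun_prop (disch := assumption)

theorem integral_sum_eq {α ι : Type*} [Fintype ι] [MeasurableSpace α] {μ : Measure α}
    {f : ι → α → ℝ} {c : ι → ℝ} (h : ∀ i, Integrable (f i) μ ∧ ∫ w, f i w ∂μ = c i) :
    Integrable (fun w ↦ ∑ i, f i w) μ ∧ ∫ w, ∑ i, f i w ∂μ = ∑ i, c i := by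
  refine ⟨integrable_finsetSum _ fun i _ ↦ (h i).1, ?_⟩
  rw [integral_finsetSum _ fun i _ ↦ (h i).1]
  exact Finset.sum_congr rfl fun i _ ↦ (h i).2

theorem integral_coord_mul_four {ι : Type*} [Fintype ι] [DecidableEq ι] [Nonempty ι]
    {μ : Measure (EuclideanSpace ℝ ι)} [IsProbabilityMeasure μ] (hμ : ∀ᵐ w ∂μ, ‖w‖ = 1)
    (hinv : ∀ R : EuclideanSpace ℝ ι ≃ₗᵢ[ℝ] EuclideanSpace ℝ ι, μ.map R = μ) (i j k l : ι) :
    Integrable (fun w : EuclideanSpace ℝ ι ↦ w i * w j * w k * w l) μ ∧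
    ∫ w : EuclideanSpace ℝ ι, w i * w j * w k * w l ∂μ =
      ((if i = j then 1 else 0) * (if k = l then 1 else 0) +
        (if i = k then 1 else 0) * (if j = l then 1 else 0) +
        (if i = l then 1 else 0) * (if j = k then 1 else 0)) /
        ((Fintype.card ι : ℝ) * (Fintype.card ι + 2)) := by
  let e (i : ι) : EuclideanSpace ℝ ι := EuclideanSpace.single i 1
  have he (i : ι) (w : EuclideanSpace ℝ ι) : inner ℝ (e i) w = w i := by
    simp [e, EuclideanSpace.inner_single_left]
  have hint (i j k l : ι) : Integrable (fun w : EuclideanSpace ℝ ι ↦ w i * w j * w k * w l) μ := by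
    simpa only [he] using integrable_inner_mul_four hμ (e i) (e j) (e k) (e l)
  refine ⟨hint i j k l, ?_⟩
  let u := e (Classical.arbitrary ι)
  have h (i j k l : ι) := integral_inner_mul_four_s16 hμ hinv (u := u) (by simp [u, e])
    (e i) (e j) (e k) (e l)
  simp only [he] at h
  generalize ∫ w : EuclideanSpace ℝ ι, inner ℝ u w ^ 4 ∂μ = C at h
  have hone : ∑ i, ∑ j, ∫ w : EuclideanSpace ℝ ι, w i * w i * w j * w j ∂μ = 1 := by
    rw [← (integral_sum_eq fun i ↦ integral_sum_eq fun j ↦ ⟨hint i i j j, rfl⟩).2]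
    rw [integral_congr_ae (g := fun _ ↦ 1)]
    · simp
    filter_upwards [hμ] with w hw
    have : ∑ i, w i * w i = 1 := by
      have := EuclideanSpace.real_norm_sq_eq w
      simpa [hw, sq, eq_comm] using this
    simp_rw [mul_assoc, ← Finset.mul_sum, ← mul_assoc, ← Finset.sum_mul, this, mul_one]
  have hC : C / 3 * (Fintype.card ι * (Fintype.card ι + 2)) = 1 := by
    rw [← hone]
    simp_rw [h, ← Finset.mul_sum]
    simp [e, PiLp.single_apply, Finset.sum_add_distrib]
    left; ring
  have hN : (0 : ℝ) < Fintype.card ι := by exact_mod_cast Fintype.card_pos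
  rw [h, eq_div_iff (by positivity), mul_right_comm, hC]
  simp [e, PiLp.single_apply]

theorem map_linearIsometryEquiv_eq {ι : Type*} [Fintype ι] [DecidableEq ι]
    {μ : Measure (EuclideanSpace ℝ ι)}
    (hinv : ∀ A ∈ Matrix.orthogonalGroup ι ℝ,
      μ.map (⇑(Matrix.toEuclideanLin A : EuclideanSpace ℝ ι →ₗ[ℝ] EuclideanSpace ℝ ι)) = μ)
    (R : EuclideanSpace ℝ ι ≃ₗᵢ[ℝ] EuclideanSpace ℝ ι) : μ.map R = μ := by
  have := hinv _ (R.toMatrix_mem_unitaryGroup (EuclideanSpace.basisFun ι ℝ)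
    (EuclideanSpace.basisFun ι ℝ))
  rw [Matrix.toEuclideanLin_eq_toLin_orthonormal, Matrix.toLin_toMatrix] at this
  exact this

theorem stmt_16 (p q r : ℕ) (hp : 1 ≤ p) (hq : 1 ≤ q) (hr : 1 ≤ r)
    (μ : Measure (EuclideanSpace ℝ (Fin p × Fin q × Fin r))) [IsProbabilityMeasure μ]
    (hsphere : μ (Metric.sphere (0 : EuclideanSpace ℝ (Fin p × Fin q × Fin r)) 1) = 1)
    (hinv : ∀ A ∈ Matrix.orthogonalGroup (Fin p × Fin q × Fin r) ℝ,
      μ.map (⇑(Matrix.toEuclideanLin A :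
        EuclideanSpace ℝ (Fin p × Fin q × Fin r) →ₗ[ℝ]
          EuclideanSpace ℝ (Fin p × Fin q × Fin r))) = μ) :
    ∫ w : EuclideanSpace ℝ (Fin p × Fin q × Fin r),
        (P₁ (fun i j k => w (i, j, k)) + P₂ (fun i j k => w (i, j, k)) +
          P₃ (fun i j k => w (i, j, k)) + 2 * P₄ (fun i j k => w (i, j, k))) / 5 ∂μ =
      (((p : ℝ) * q + p * r + q * r) + 3 * ((p : ℝ) + q + r) + 3) /
        (5 * ((p : ℝ) * q * r + 2)) := by
  have : NeZero p := ⟨by omega⟩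
  have : NeZero q := ⟨by omega⟩
  have : NeZero r := ⟨by omega⟩
  have hμ : ∀ᵐ w ∂μ, ‖w‖ = 1 := by
    have := (prob_compl_eq_zero_iff Metric.isClosed_sphere.measurableSet).2 hsphere
    simpa [ae_iff, Set.compl_def] using this
  have M := integral_coord_mul_four hμ (map_linearIsometryEquiv_eq hinv)
  have h₁ := integral_sum_eq fun a : Fin p ↦ integral_sum_eq fun b : Fin p ↦
    integral_sum_eq fun c : Fin q ↦ integral_sum_eq fun d : Fin q ↦
    integral_sum_eq fun e : Fin r ↦ integral_sum_eq fun f : Fin r ↦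
    M (a, c, e) (a, d, f) (b, c, e) (b, d, f)
  have h₂ := integral_sum_eq fun a : Fin p ↦ integral_sum_eq fun b : Fin p ↦
    integral_sum_eq fun c : Fin q ↦ integral_sum_eq fun d : Fin q ↦
    integral_sum_eq fun e : Fin r ↦ integral_sum_eq fun f : Fin r ↦
    M (a, c, e) (a, d, e) (b, c, f) (b, d, f)
  have h₃ := integral_sum_eq fun a : Fin p ↦ integral_sum_eq fun b : Fin p ↦
    integral_sum_eq fun c : Fin q ↦ integral_sum_eq fun d : Fin q ↦
    integral_sum_eq fun e : Fin r ↦ integral_sum_eq fun f : Fin r ↦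
    M (a, c, e) (a, c, f) (b, d, e) (b, d, f)
  have h₄ := integral_sum_eq fun a : Fin p ↦ integral_sum_eq fun b : Fin p ↦
    integral_sum_eq fun c : Fin q ↦ integral_sum_eq fun d : Fin q ↦
    integral_sum_eq fun e : Fin r ↦ integral_sum_eq fun f : Fin r ↦
    M (a, c, e) (a, d, f) (b, d, e) (b, c, f)
  have hp' : (0 : ℝ) < p := by exact_mod_cast hp
  have hq' : (0 : ℝ) < q := by exact_mod_cast hq
  have hr' : (0 : ℝ) < r := by exact_mod_cast hr
  rw [integral_div]
  change (∫ w : EuclideanSpace ℝ (Fin p × Fin q × Fin r),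
    (∑ a, ∑ b, ∑ c, ∑ d, ∑ e, ∑ f, w (a, c, e) * w (a, d, f) * w (b, c, e) * w (b, d, f) +
    ∑ a, ∑ b, ∑ c, ∑ d, ∑ e, ∑ f, w (a, c, e) * w (a, d, e) * w (b, c, f) * w (b, d, f) +
    ∑ a, ∑ b, ∑ c, ∑ d, ∑ e, ∑ f, w (a, c, e) * w (a, c, f) * w (b, d, e) * w (b, d, f) +
    2 * ∑ a, ∑ b, ∑ c, ∑ d, ∑ e, ∑ f,
      w (a, c, e) * w (a, d, f) * w (b, d, e) * w (b, c, f)) ∂μ) / 5 = _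
  rw [integral_add ((h₁.1.fun_add h₂.1).fun_add h₃.1) (h₄.1.const_mul 2),
    integral_add (h₁.1.fun_add h₂.1) h₃.1, integral_add h₁.1 h₂.1, integral_const_mul,
    h₁.2, h₂.2, h₃.2, h₄.2]
  simp only [← Finset.sum_div, Prod.mk.injEq, true_and, and_true, ite_and]
  simp [Finset.sum_add_distrib]
  field_simp
  ring
end
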